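/- arXiv:1703.06608 — 7 statements merged into one kernel-verified Lean document; each statement's English description precedes it below -/
import Mathlib

section
/- The function f(x) = (1 − e^{x/tan x − 1})/(1 − cos x) is strictly decreasing on (0, π/2), with limit 2/3 as x → 0⁺ and limit (e−1)/e as x → π/2⁻; in particular its range on (0, π/2) is the interval ((e−1)/e, 2/3). -/
open Real

/-- f(x) = (1 − e^{x/tan x − 1})/(1 − cos x) -/
noncomputable def f (x : ℝ) : ℝ :=
  (1 - Real.exp (x / Real.tan x - 1)) / (1 - Real.cos x)

open Set Filter Topology

lemma f_eq (x : ℝ) : f x = (1 - exp (x * cos x / sin x - 1)) / (1 - cos x) := by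
  rw [f, tan_eq_sin_div_cos, div_div_eq_mul_div]

lemma sin_pos_of_mem_Ioo_zero_pi_div_two {x : ℝ} (hx : x ∈ Ioo 0 (π / 2)) : 0 < sin x :=
  sin_pos_of_pos_of_lt_pi hx.1 (by linarith [hx.2, pi_pos])

lemma cos_pos_of_mem_Ioo_zero_pi_div_two {x : ℝ} (hx : x ∈ Ioo 0 (π / 2)) : 0 < cos x :=
  cos_pos_of_mem_Ioo ⟨by linarith [hx.1, pi_pos], hx.2⟩

lemma one_sub_cos_pos {x : ℝ} (hx : x ∈ Ioo 0 (π / 2)) : 0 < 1 - cos x := by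
  nlinarith [sin_sq_add_cos_sq x, sin_pos_of_mem_Ioo_zero_pi_div_two hx,
    cos_pos_of_mem_Ioo_zero_pi_div_two hx]

lemma mul_seven_add_lt {c w : ℝ} (h0 : 0 < c) (h1 : c < 1) (hw : 0 < w) (hsq : w ^ 2 = 8 + c ^ 2) :
    c * (7 + 2 * c ^ 2) < (1 + 2 * c ^ 2) * w := by
  refine lt_of_pow_lt_pow_left₀ 2 (by positivity) ?_
  rw [mul_pow _ w, hsq]
  have : 0 < (1 - c ^ 2) ^ 2 := by
    have : 0 < 1 - c ^ 2 := by nlinarith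
    positivity
  linarith [show (1 + 2 * c ^ 2) ^ 2 * (8 + c ^ 2) - (c * (7 + 2 * c ^ 2)) ^ 2
    = 8 * (1 - c ^ 2) ^ 2 by ring]

lemma sin_mul_sqrt_sub_cos_lt {x : ℝ} (hx : x ∈ Ioo 0 (π / 2)) :
    sin x * (√(8 + cos x ^ 2) - cos x) / 2 < x := by
  have hmono : StrictMonoOn (fun x => x - sin x * (√(8 + cos x ^ 2) - cos x) / 2)
      (Icc 0 (π / 2)) := by
    refine strictMonoOn_of_deriv_pos (convex_Icc _ _) (by fun_prop) fun y hy => ?_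
    rw [interior_Icc] at hy
    have hc := cos_pos_of_mem_Ioo_zero_pi_div_two hy
    have hc1 : cos y < 1 := by linarith [one_sub_cos_pos hy]
    have hw : 0 < √(8 + cos y ^ 2) := by positivity
    have hsq : √(8 + cos y ^ 2) ^ 2 = 8 + cos y ^ 2 := sq_sqrt (by positivity)
    have hd := (hasDerivAt_id' y).fun_sub (((hasDerivAt_sin y).fun_mul
      (((((hasDerivAt_cos y).fun_pow 2).const_add 8).sqrt (by positivity)).fun_sub
        (hasDerivAt_cos y))).div_const 2)
    have hlt := mul_seven_add_lt hc hc1 hw hsq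
    refine lt_of_lt_of_eq ?_ hd.deriv.symm
    generalize √(8 + cos y ^ 2) = w at *
    have hs : sin y ^ 2 = 1 - cos y ^ 2 := sin_sq y
    have : (1 + 2 * cos y ^ 2) * w - cos y * (7 + 2 * cos y ^ 2) > 0 := by linarith
    refine lt_of_lt_of_eq (div_pos this (mul_pos two_pos hw)) ?_
    field_simp
    push_cast
    norm_num
    linear_combination (2 * w - 2 * cos y) * hs + 2 * cos y * hsq
  have := hmono ⟨le_rfl, by positivity⟩ ⟨hx.1.le, hx.2.le⟩ hx.1
  simp only [sin_zero] at this
  linarith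

lemma two_mul_sin_pow_four_lt {x : ℝ} (hx : x ∈ Ioo 0 (π / 2)) :
    2 * sin x ^ 4 < (x - sin x * cos x) ^ 2 + 3 * cos x * sin x * (x - sin x * cos x) := by
  have hs := sin_pos_of_mem_Ioo_zero_pi_div_two hx
  have hc := cos_pos_of_mem_Ioo_zero_pi_div_two hx
  have hlt := sin_mul_sqrt_sub_cos_lt hx
  have hw : 0 < √(8 + cos x ^ 2) := by positivity
  have hsq : √(8 + cos x ^ 2) ^ 2 = 8 + cos x ^ 2 := sq_sqrt (by positivity)
  generalize √(8 + cos x ^ 2) = w at *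
  have h1 : 0 < x - sin x * (w - cos x) / 2 := by linarith
  have h2 : 0 < x + sin x * (w + cos x) / 2 := by
    have := hx.1
    positivity
  have h := mul_pos h1 h2
  have hs2 : sin x ^ 2 = 1 - cos x ^ 2 := sin_sq x
  linear_combination h - sin x ^ 2 / 4 * hsq + 2 * sin x ^ 2 * hs2

lemma hasDerivAt_exp_mul_cot {x : ℝ} (hs : sin x ≠ 0) :
    HasDerivAt (fun x => exp (x * cos x / sin x - 1))
      (-(exp (x * cos x / sin x - 1) * ((x - sin x * cos x) / sin x ^ 2))) x := by
  refine ((((hasDerivAt_id' x).fun_mul (hasDerivAt_cos x)).fun_div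
    (hasDerivAt_sin x) hs).sub_const 1).exp.congr_deriv ?_
  rw [← mul_neg]
  congr 1
  field_simp
  linear_combination -x * sin_sq_add_cos_sq x

lemma hasDerivAt_sub_sin_mul_cos (x : ℝ) :
    HasDerivAt (fun x => x - sin x * cos x) (2 * sin x ^ 2) x := by
  refine ((hasDerivAt_id' x).fun_sub
    ((hasDerivAt_sin x).fun_mul (hasDerivAt_cos x))).congr_deriv ?_
  linear_combination -sin_sq_add_cos_sq x

lemma hasDerivAt_sin_pow_three (x : ℝ) :
    HasDerivAt (fun x => sin x ^ 3) (3 * sin x ^ 2 * cos x) x := by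
  simpa using (hasDerivAt_sin x).fun_pow 3

lemma hasDerivAt_one_sub_cos (x : ℝ) : HasDerivAt (fun x => 1 - cos x) (sin x) x := by
  simpa using (hasDerivAt_cos x).const_sub 1

/-- The quotient of the derivatives of the numerator and the denominator of `f`. -/
noncomputable def derivRatio (x : ℝ) : ℝ :=
  exp (x * cos x / sin x - 1) * ((x - sin x * cos x) / sin x ^ 3)

lemma hasDerivAt_one_sub_exp_mul_cot {x : ℝ} (hs : sin x ≠ 0) :
    HasDerivAt (fun x => 1 - exp (x * cos x / sin x - 1)) (derivRatio x * sin x) x := by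
  refine ((hasDerivAt_exp_mul_cot hs).const_sub 1).congr_deriv ?_
  rw [derivRatio, neg_neg, mul_assoc]
  congr 1
  field_simp

lemma strictAntiOn_derivRatio : StrictAntiOn derivRatio (Ioo 0 (π / 2)) := by
  have hd : ∀ x ∈ Ioo 0 (π / 2), HasDerivAt derivRatio
      (exp (x * cos x / sin x - 1) * ((2 * sin x ^ 4 - ((x - sin x * cos x) ^ 2
        + 3 * cos x * sin x * (x - sin x * cos x))) / sin x ^ 5)) x := fun x hx => by
    have hs := (sin_pos_of_mem_Ioo_zero_pi_div_two hx).ne'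
    refine ((hasDerivAt_exp_mul_cot hs).fun_mul ((hasDerivAt_sub_sin_mul_cos x).fun_div
      (hasDerivAt_sin_pow_three x) (pow_ne_zero 3 hs))).congr_deriv ?_
    field_simp
    ring
  refine strictAntiOn_of_deriv_neg (convex_Ioo _ _)
    (fun x hx => (hd x hx).continuousAt.continuousWithinAt) fun x hx => ?_
  rw [interior_Ioo] at hx
  have hs := sin_pos_of_mem_Ioo_zero_pi_div_two hx
  rw [(hd x hx).deriv]
  exact mul_neg_of_pos_of_neg (exp_pos _) (div_neg_of_neg_of_pos
    (by linarith [two_mul_sin_pow_four_lt hx]) (by positivity))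

lemma tendsto_mul_cot_nhdsGT_zero :
    Tendsto (fun x => x * cos x / sin x) (𝓝[>] 0) (𝓝 1) := by
  have h : Tendsto (fun x => cos x / sinc x) (𝓝[>] 0) (𝓝 1) := by
    have := (continuous_cos.tendsto 0).div (continuous_sinc.tendsto 0) (by simp)
    simp only [cos_zero, sinc_zero, div_one] at this
    exact this.mono_left nhdsWithin_le_nhds
  refine h.congr' ?_
  filter_upwards [self_mem_nhdsWithin] with x hx
  rw [sinc_of_ne_zero (ne_of_gt hx), div_div_eq_mul_div, mul_comm]

lemma tendsto_exp_mul_cot_nhdsGT_zero :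
    Tendsto (fun x => exp (x * cos x / sin x - 1)) (𝓝[>] 0) (𝓝 1) := by
  simpa using (tendsto_mul_cot_nhdsGT_zero.sub_const 1).rexp

lemma tendsto_nhdsGT_zero {g : ℝ → ℝ} (hg : Continuous g) (h0 : g 0 = 0) :
    Tendsto g (𝓝[>] 0) (𝓝 0) := by
  simpa [h0] using (hg.tendsto 0).mono_left nhdsWithin_le_nhds

lemma tendsto_derivRatio_nhdsGT_zero : Tendsto derivRatio (𝓝[>] 0) (𝓝 (2 / 3)) := by
  have h : Tendsto (fun x => (x - sin x * cos x) / sin x ^ 3) (𝓝[>] 0) (𝓝 (2 / 3)) := by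
    refine HasDerivAt.lhopital_zero_right_on_Ioo (b := π / 2) (by positivity)
      (fun x _ => hasDerivAt_sub_sin_mul_cos x) (fun x _ => hasDerivAt_sin_pow_three x)
      (fun x hx => ?_) (tendsto_nhdsGT_zero (by fun_prop) (by simp))
      (tendsto_nhdsGT_zero (by fun_prop) (by simp)) ?_
    · have hs := sin_pos_of_mem_Ioo_zero_pi_div_two hx
      have hc := cos_pos_of_mem_Ioo_zero_pi_div_two hx
      positivity
    · have h : Tendsto (fun x => 2 / (3 * cos x)) (𝓝[>] 0) (𝓝 (2 / 3)) := by
        have := (tendsto_const_nhds (x := (2 : ℝ))).div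
          ((continuous_cos.tendsto 0).const_mul 3) (by simp)
        simp only [cos_zero, mul_one] at this
        exact this.mono_left nhdsWithin_le_nhds
      refine h.congr' ?_
      filter_upwards [Ioo_mem_nhdsGT (show (0 : ℝ) < π / 2 by positivity)] with x hx
      have hs := sin_pos_of_mem_Ioo_zero_pi_div_two hx
      have hc := cos_pos_of_mem_Ioo_zero_pi_div_two hx
      field_simp
  exact one_mul (2 / 3 : ℝ) ▸ tendsto_exp_mul_cot_nhdsGT_zero.mul h

lemma tendsto_one_sub_exp_mul_cot_nhdsGT_zero :
    Tendsto (fun x => 1 - exp (x * cos x / sin x - 1)) (𝓝[>] 0) (𝓝 0) := by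
  simpa using tendsto_exp_mul_cot_nhdsGT_zero.const_sub 1

lemma tendsto_one_sub_cos_nhdsGT_zero : Tendsto (fun x => 1 - cos x) (𝓝[>] 0) (𝓝 0) :=
  tendsto_nhdsGT_zero (by fun_prop) (by simp)

lemma tendsto_f_nhdsGT_zero : Tendsto f (𝓝[>] 0) (𝓝 (2 / 3)) := by
  rw [funext f_eq]
  refine HasDerivAt.lhopital_zero_right_on_Ioo (b := π / 2) (by positivity)
    (fun x hx => hasDerivAt_one_sub_exp_mul_cot (sin_pos_of_mem_Ioo_zero_pi_div_two hx).ne')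
    (fun x _ => hasDerivAt_one_sub_cos x)
    (fun x hx => (sin_pos_of_mem_Ioo_zero_pi_div_two hx).ne')
    tendsto_one_sub_exp_mul_cot_nhdsGT_zero tendsto_one_sub_cos_nhdsGT_zero
    (tendsto_derivRatio_nhdsGT_zero.congr' ?_)
  filter_upwards [Ioo_mem_nhdsGT (show (0 : ℝ) < π / 2 by positivity)] with x hx
  rw [mul_div_cancel_right₀ _ (sin_pos_of_mem_Ioo_zero_pi_div_two hx).ne']

lemma tendsto_f_nhdsLT_pi_div_two :
    Tendsto f (𝓝[<] (π / 2)) (𝓝 ((exp 1 - 1) / exp 1)) := by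
  have h : ContinuousAt (fun x => (1 - exp (x * cos x / sin x - 1)) / (1 - cos x)) (π / 2) := by
    fun_prop (disch := simp)
  have he : (1 - exp (π / 2 * cos (π / 2) / sin (π / 2) - 1)) / (1 - cos (π / 2))
      = (exp 1 - 1) / exp 1 := by
    rw [cos_pi_div_two, sin_pi_div_two, sub_div (exp 1), div_self (exp_ne_zero 1)]
    simp [exp_neg]
  rw [funext f_eq, ← he]
  exact h.tendsto.mono_left nhdsWithin_le_nhds

lemma hasDerivAt_f {x : ℝ} (hx : x ∈ Ioo 0 (π / 2)) :
    HasDerivAt f (sin x * (derivRatio x - f x) / (1 - cos x)) x := by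
  have hc := one_sub_cos_pos hx
  rw [f_eq, funext f_eq]
  refine ((hasDerivAt_one_sub_exp_mul_cot (sin_pos_of_mem_Ioo_zero_pi_div_two hx).ne').fun_div
    (hasDerivAt_one_sub_cos x) hc.ne').congr_deriv ?_
  field_simp

lemma derivRatio_lt_f {x : ℝ} (hx : x ∈ Ioo 0 (π / 2)) : derivRatio x < f x := by
  have hsub : ∀ y ∈ Ioo 0 x, y ∈ Ioo 0 (π / 2) := fun y hy => ⟨hy.1, hy.2.trans hx.2⟩
  obtain ⟨y, hy, h⟩ := exists_ratio_hasDerivAt_eq_ratio_slope'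
    (fun x => 1 - exp (x * cos x / sin x - 1)) (fun x => derivRatio x * sin x) hx.1
    (fun x => 1 - cos x) sin
    (fun y hy => hasDerivAt_one_sub_exp_mul_cot
      (sin_pos_of_mem_Ioo_zero_pi_div_two (hsub y hy)).ne')
    (fun y _ => hasDerivAt_one_sub_cos y)
    tendsto_one_sub_exp_mul_cot_nhdsGT_zero tendsto_one_sub_cos_nhdsGT_zero
    ((hasDerivAt_one_sub_exp_mul_cot
      (sin_pos_of_mem_Ioo_zero_pi_div_two hx).ne').continuousAt.tendsto.mono_left
        nhdsWithin_le_nhds)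
    ((hasDerivAt_one_sub_cos x).continuousAt.tendsto.mono_left nhdsWithin_le_nhds)
  have hs := sin_pos_of_mem_Ioo_zero_pi_div_two (hsub y hy)
  have hf : f x = derivRatio y := by
    rw [f_eq, div_eq_iff (one_sub_cos_pos hx).ne']
    refine mul_right_cancel₀ hs.ne' ?_
    linear_combination -h
  rw [hf]
  exact strictAntiOn_derivRatio (hsub y hy) hx hy.2

lemma continuousOn_f : ContinuousOn f (Ioo 0 (π / 2)) :=
  fun _ hx => (hasDerivAt_f hx).continuousAt.continuousWithinAt

lemma strictAntiOn_f : StrictAntiOn f (Ioo 0 (π / 2)) := by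
  refine strictAntiOn_of_deriv_neg (convex_Ioo _ _) continuousOn_f fun x hx => ?_
  rw [interior_Ioo] at hx
  rw [(hasDerivAt_f hx).deriv]
  exact div_neg_of_neg_of_pos (mul_neg_of_pos_of_neg (sin_pos_of_mem_Ioo_zero_pi_div_two hx)
    (sub_neg.2 (derivRatio_lt_f hx))) (one_sub_cos_pos hx)

/-- The image of an open interval under a continuous strictly antitone function is the open
interval between its one-sided limits. -/
lemma StrictAntiOn.image_Ioo_eq_of_tendsto {g : ℝ → ℝ} {a b l m : ℝ} (hab : a < b)
    (hg : StrictAntiOn g (Ioo a b)) (hc : ContinuousOn g (Ioo a b))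
    (ha : Tendsto g (𝓝[>] a) (𝓝 m)) (hb : Tendsto g (𝓝[<] b) (𝓝 l)) :
    g '' Ioo a b = Ioo l m := by
  refine Subset.antisymm ?_ (isPreconnected_Ioo.intermediate_value_Ioo
    (le_principal_iff.2 (Ioo_mem_nhdsLT hab)) (le_principal_iff.2 (Ioo_mem_nhdsGT hab)) hc hb ha)
  rintro _ ⟨x, hx, rfl⟩
  constructor
  · obtain ⟨y, hxy, hyb⟩ := exists_between hx.2
    have hy : y ∈ Ioo a b := ⟨hx.1.trans hxy, hyb⟩
    refine lt_of_le_of_lt (le_of_tendsto hb ?_) (hg hx hy hxy)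
    filter_upwards [Ioo_mem_nhdsLT hyb] with z hz
    exact (hg hy ⟨hy.1.trans hz.1, hz.2⟩ hz.1).le
  · obtain ⟨y, hay, hyx⟩ := exists_between hx.1
    have hy : y ∈ Ioo a b := ⟨hay, hyx.trans hx.2⟩
    refine lt_of_lt_of_le (hg hy hx hyx) (ge_of_tendsto ha ?_)
    filter_upwards [Ioo_mem_nhdsGT hay] with z hz
    exact (hg ⟨hz.1, hz.2.trans hy.2⟩ hy hz.2).le

theorem stmt_11 :
    StrictAntiOn f (Set.Ioo 0 (π / 2)) ∧
    Filter.Tendsto f (nhdsWithin 0 (Set.Ioi 0)) (nhds (2 / 3)) ∧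
    Filter.Tendsto f (nhdsWithin (π / 2) (Set.Iio (π / 2)))
      (nhds ((Real.exp 1 - 1) / Real.exp 1)) ∧
    f '' Set.Ioo 0 (π / 2) = Set.Ioo ((Real.exp 1 - 1) / Real.exp 1) (2 / 3) :=
  ⟨strictAntiOn_f, tendsto_f_nhdsGT_zero, tendsto_f_nhdsLT_pi_div_two,
    strictAntiOn_f.image_Ioo_eq_of_tendsto (by positivity) continuousOn_f tendsto_f_nhdsGT_zero
      tendsto_f_nhdsLT_pi_div_two⟩
end

section
/- For every x ∈ (0, π/2), one has 1 + cos x − e^{x/tan x − 1} < (sin x)/x < c·(1 + cos x − e^{x/tan x − 1}), where c = 2e/(π(e−1)). -/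
open Real

lemma nonneg_of_hasDerivAt_nonneg {f f' : ℝ → ℝ} (hf : ∀ x, HasDerivAt f (f' x) x)
    (h0 : f 0 = 0) (h : ∀ x, 0 ≤ x → 0 ≤ f' x) {x : ℝ} (hx : 0 ≤ x) : 0 ≤ f x := by
  have hmono : MonotoneOn f (Set.Ici 0) := by
    refine monotoneOn_of_deriv_nonneg (convex_Ici 0)
      (fun y _ => (hf y).continuousAt.continuousWithinAt)
      (fun y _ => (hf y).differentiableAt.differentiableWithinAt) fun y hy => ?_
    rw [interior_Ici] at hy
    rw [(hf y).deriv]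
    exact h y (le_of_lt hy)
  simpa [h0] using hmono Set.self_mem_Ici hx hx

/-- Partial sums of the exponential series of `-x`. -/
noncomputable def expNegSum (n : ℕ) (x : ℝ) : ℝ :=
  ∑ i ∈ Finset.range n, (-1) ^ i * x ^ i / (i.factorial : ℝ)

/-- Partial sums of the cosine series. -/
noncomputable def cosSum (n : ℕ) (x : ℝ) : ℝ :=
  ∑ i ∈ Finset.range n, (-1) ^ i * x ^ (2 * i) / ((2 * i).factorial : ℝ)

/-- Partial sums of the sine series. -/
noncomputable def sinSum (n : ℕ) (x : ℝ) : ℝ :=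
  ∑ i ∈ Finset.range n, (-1) ^ i * x ^ (2 * i + 1) / ((2 * i + 1).factorial : ℝ)

lemma hasDerivAt_expNegSum_succ (n : ℕ) (x : ℝ) :
    HasDerivAt (expNegSum (n + 1)) (-expNegSum n x) x := by
  have h : HasDerivAt (fun y : ℝ => ∑ i ∈ Finset.range n,
      (-1) ^ (i + 1) * y ^ (i + 1) / ((i + 1).factorial : ℝ) + 1) (-expNegSum n x) x := by
    refine HasDerivAt.add_const _ ?_
    rw [expNegSum, ← Finset.sum_neg_distrib]
    refine HasDerivAt.fun_sum fun i _ => ?_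
    refine (((hasDerivAt_pow (i + 1) x).const_mul
      ((-1 : ℝ) ^ (i + 1))).div_const _).congr_deriv ?_
    rw [Nat.factorial_succ]
    push_cast
    have : (i.factorial : ℝ) ≠ 0 := by positivity
    have : (i : ℝ) + 1 ≠ 0 := by positivity
    field_simp
    ring
  convert h using 1
  funext y
  simp [expNegSum, Finset.sum_range_succ']

lemma hasDerivAt_sinSum (n : ℕ) (x : ℝ) : HasDerivAt (sinSum n) (cosSum n x) x := by
  refine HasDerivAt.fun_sum fun i _ => ?_
  refine (((hasDerivAt_pow (2 * i + 1) x).const_mul ((-1 : ℝ) ^ i)).div_const _).congr_deriv ?_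
  rw [Nat.factorial_succ]
  push_cast
  have : ((2 * i).factorial : ℝ) ≠ 0 := by positivity
  have : 2 * (i : ℝ) + 1 ≠ 0 := by positivity
  field_simp

lemma hasDerivAt_cosSum_succ (n : ℕ) (x : ℝ) :
    HasDerivAt (cosSum (n + 1)) (-sinSum n x) x := by
  have h : HasDerivAt (fun y : ℝ => ∑ i ∈ Finset.range n,
      (-1) ^ (i + 1) * y ^ (2 * i + 1 + 1) / ((2 * i + 1 + 1).factorial : ℝ) + 1)
      (-sinSum n x) x := by
    refine HasDerivAt.add_const _ ?_
    rw [sinSum, ← Finset.sum_neg_distrib]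
    refine HasDerivAt.fun_sum fun i _ => ?_
    refine (((hasDerivAt_pow (2 * i + 1 + 1) x).const_mul
      ((-1 : ℝ) ^ (i + 1))).div_const _).congr_deriv ?_
    rw [Nat.factorial_succ]
    push_cast
    have : ((2 * i + 1).factorial : ℝ) ≠ 0 := by positivity
    have : 2 * (i : ℝ) + 1 + 1 ≠ 0 := by positivity
    field_simp
    ring
  convert h using 1
  funext y
  simp [cosSum, Finset.sum_range_succ', mul_add]

lemma expNegSum_alternating (n : ℕ) :
    ∀ x : ℝ, 0 ≤ x → 0 ≤ (-1) ^ n * (exp (-x) - expNegSum n x) := by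
  induction n with
  | zero => intro x _; simp [expNegSum, (exp_pos _).le]
  | succ n ih =>
    intro x hx
    refine nonneg_of_hasDerivAt_nonneg (f := fun x => (-1) ^ (n + 1) *
      (exp (-x) - expNegSum (n + 1) x)) (fun y => ?_) ?_ ih hx
    · refine ((((hasDerivAt_id y).fun_neg.exp).sub (hasDerivAt_expNegSum_succ n y)).const_mul
        ((-1 : ℝ) ^ (n + 1))).congr_deriv ?_
      simp only [id]
      ring
    · simp [expNegSum, Finset.sum_range_succ']

lemma cosSum_sinSum_alternating (n : ℕ) :
    (∀ x : ℝ, 0 ≤ x → 0 ≤ (-1) ^ (n + 1) * (cos x - cosSum (n + 1) x)) ∧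
      ∀ x : ℝ, 0 ≤ x → 0 ≤ (-1) ^ (n + 1) * (sin x - sinSum (n + 1) x) := by
  have sin_of_cos (n : ℕ)
      (hc : ∀ x : ℝ, 0 ≤ x → 0 ≤ (-1) ^ n * (cos x - cosSum n x)) :
      ∀ x : ℝ, 0 ≤ x → 0 ≤ (-1) ^ n * (sin x - sinSum n x) := fun x hx =>
    nonneg_of_hasDerivAt_nonneg (f := fun x => (-1) ^ n * (sin x - sinSum n x))
      (fun y => ((hasDerivAt_sin y).sub (hasDerivAt_sinSum n y)).const_mul _)
      (by simp [sinSum]) hc hx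
  induction n with
  | zero =>
    have hc : ∀ x : ℝ, 0 ≤ x → 0 ≤ (-1) ^ (0 + 1) * (cos x - cosSum (0 + 1) x) := by
      intro x _
      simp [cosSum, cos_le_one]
    exact ⟨hc, sin_of_cos _ hc⟩
  | succ n ih =>
    have hc : ∀ x : ℝ, 0 ≤ x → 0 ≤ (-1) ^ (n + 1 + 1) * (cos x - cosSum (n + 1 + 1) x) := by
      intro x hx
      refine nonneg_of_hasDerivAt_nonneg (f := fun x => (-1) ^ (n + 1 + 1) *
        (cos x - cosSum (n + 1 + 1) x)) (fun y => ?_) ?_ ih.2 hx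
      · refine (((hasDerivAt_cos y).sub (hasDerivAt_cosSum_succ (n + 1) y)).const_mul
          ((-1 : ℝ) ^ (n + 1 + 1))).congr_deriv ?_
        ring
      · simp [cosSum, Finset.sum_range_succ']
    exact ⟨hc, sin_of_cos _ hc⟩

section TaylorBounds

variable {x t : ℝ}

lemma sin_le_taylor (hx : 0 ≤ x) (ht : t = x ^ 2) :
    sin x ≤ x * (1 - t / 6 + t ^ 2 / 120 - t ^ 3 / 5040 + t ^ 4 / 362880) := by
  have h := (cosSum_sinSum_alternating 4).2 x hx
  norm_num [sinSum, Finset.sum_range_succ, Nat.factorial] at h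
  subst ht
  linarith

lemma taylor_le_sin (hx : 0 ≤ x) (ht : t = x ^ 2) :
    x * (1 - t / 6 + t ^ 2 / 120 - t ^ 3 / 5040) ≤ sin x := by
  have h := (cosSum_sinSum_alternating 3).2 x hx
  norm_num [sinSum, Finset.sum_range_succ, Nat.factorial] at h
  subst ht
  linarith

lemma cos_le_taylor (hx : 0 ≤ x) (ht : t = x ^ 2) :
    cos x ≤ 1 - t / 2 + t ^ 2 / 24 - t ^ 3 / 720 + t ^ 4 / 40320 := by
  have h := (cosSum_sinSum_alternating 4).1 x hx
  norm_num [cosSum, Finset.sum_range_succ, Nat.factorial] at h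
  subst ht
  linarith

lemma taylor_le_cos (hx : 0 ≤ x) (ht : t = x ^ 2) :
    1 - t / 2 + t ^ 2 / 24 - t ^ 3 / 720 + t ^ 4 / 40320 - t ^ 5 / 3628800 ≤ cos x := by
  have h := (cosSum_sinSum_alternating 5).1 x hx
  norm_num [cosSum, Finset.sum_range_succ, Nat.factorial] at h
  subst ht
  linarith

lemma sub_cube_le_sin (hx : 0 ≤ x) : x - x ^ 3 / 6 ≤ sin x := by
  have h := (cosSum_sinSum_alternating 1).2 x hx
  norm_num [sinSum, Finset.sum_range_succ, Nat.factorial] at h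
  linarith

lemma sin_le_quintic (hx : 0 ≤ x) : sin x ≤ x - x ^ 3 / 6 + x ^ 5 / 120 := by
  have h := (cosSum_sinSum_alternating 2).2 x hx
  norm_num [sinSum, Finset.sum_range_succ, Nat.factorial] at h
  linarith

lemma cos_le_quartic (hx : 0 ≤ x) : cos x ≤ 1 - x ^ 2 / 2 + x ^ 4 / 24 := by
  have h := (cosSum_sinSum_alternating 2).1 x hx
  norm_num [cosSum, Finset.sum_range_succ, Nat.factorial] at h
  linarith

lemma exp_le_quartic_of_nonpos (hx : x ≤ 0) :
    exp x ≤ 1 + x + x ^ 2 / 2 + x ^ 3 / 6 + x ^ 4 / 24 := by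
  have h := expNegSum_alternating 5 (-x) (neg_nonneg.2 hx)
  norm_num [expNegSum, Finset.sum_range_succ, Nat.factorial] at h
  linarith

lemma quintic_le_exp_of_nonpos (hx : x ≤ 0) :
    1 + x + x ^ 2 / 2 + x ^ 3 / 6 + x ^ 4 / 24 + x ^ 5 / 120 ≤ exp x := by
  have h := expNegSum_alternating 6 (-x) (neg_nonneg.2 hx)
  norm_num [expNegSum, Finset.sum_range_succ, Nat.factorial] at h
  linarith

end TaylorBounds

lemma one_add_cos_sub_sinc_poly_lt_exp_poly {t P : ℝ} (h0 : 0 < t) (hT : t < 5 / 2)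
    (hP : P = -t / 3 - t ^ 2 / 45 - t ^ 3 / 450 - 3 * t ^ 4 / 10000) :
    1 + (1 - t / 2 + t ^ 2 / 24 - t ^ 3 / 720 + t ^ 4 / 40320) - (1 - t / 6 + t ^ 2 / 120 -
      t ^ 3 / 5040) <
      1 + P + P ^ 2 / 2 + P ^ 3 / 6 + P ^ 4 / 24 + P ^ 5 / 120 := by
  have hs : 0 < 5 / 2 - t := sub_pos.2 hT
  refine sub_pos.1 ?_
  calc
    0 < t ^ 3 * (376832 / 10814666748046875 * (5 / 2 - t) ^ 17 +
      92099072 / 162220001220703125 * t * (5 / 2 - t) ^ 16 +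
      712947712 / 162220001220703125 * t ^ 2 * (5 / 2 - t) ^ 15 +
      895304192 / 41713714599609375 * t ^ 3 * (5 / 2 - t) ^ 14 +
      3087510016 / 41713714599609375 * t ^ 4 * (5 / 2 - t) ^ 13 +
      119573626792 / 625705718994140625 * t ^ 5 * (5 / 2 - t) ^ 12 +
      430281674132 / 1126270294189453125 * t ^ 6 * (5 / 2 - t) ^ 11 +
      71327781069127 / 118258380889892578125 * t ^ 7 * (5 / 2 - t) ^ 10 +
      5992101809236 / 7883892059326171875 * t ^ 8 * (5 / 2 - t) ^ 9 +
      2904077694491219 / 3784268188476562500000 * t ^ 9 * (5 / 2 - t) ^ 8 +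
      8271038659369 / 13348388671875000000 * t ^ 10 * (5 / 2 - t) ^ 7 +
      1716763285644211 / 4324877929687500000000 * t ^ 11 * (5 / 2 - t) ^ 6 +
      573199958573479 / 2883251953125000000000 * t ^ 12 * (5 / 2 - t) ^ 5 +
      42062337141022009 / 553584375000000000000000 * t ^ 13 * (5 / 2 - t) ^ 4 +
      55082253190049557 / 2583393750000000000000000 * t ^ 14 * (5 / 2 - t) ^ 3 +
      12767335155795083 / 3100072500000000000000000 * t ^ 15 * (5 / 2 - t) ^ 2 +
      3342472868212213 / 6889050000000000000000000 * t ^ 16 * (5 / 2 - t) +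
      18370088878920773 / 708588000000000000000000000 * t ^ 17) := by
      positivity
    _ = _ := by
      rw [hP]
      ring

lemma lower_poly_mul_sin_poly_lt_cos_poly {t P : ℝ} (h0 : 0 < t) (hT : t < 5 / 2)
    (hP : P = -t / 3 - t ^ 2 / 45 - t ^ 3 / 450 - 3 * t ^ 4 / 10000) :
    (1 + P) * (1 - t / 6 + t ^ 2 / 120 - t ^ 3 / 5040 + t ^ 4 / 362880) <
      (1 - t / 2 + t ^ 2 / 24 - t ^ 3 / 720 + t ^ 4 / 40320 - t ^ 5 / 3628800) := by
  have hs : 0 < 5 / 2 - t := sub_pos.2 hT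
  refine sub_pos.1 ?_
  calc
    0 < t ^ 3 * (16 / 14765625 * (5 / 2 - t) ^ 5 +
      1601 / 221484375 * t * (5 / 2 - t) ^ 4 +
      336419 / 21262500000 * t ^ 2 * (5 / 2 - t) ^ 3 +
      974083 / 63787500000 * t ^ 3 * (5 / 2 - t) ^ 2 +
      4421 / 675000000 * t ^ 4 * (5 / 2 - t) +
      3906767 / 4082400000000 * t ^ 5) := by
      positivity
    _ = _ := by
      rw [hP]
      ring

lemma sinc_poly_lt_mul_sub_exp_poly {t Q : ℝ} (h0 : 0 < t) (hT : t < 121 / 100)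
    (hQ : Q = -t / 3 - t ^ 2 / 45) :
    1 - t / 6 + t ^ 2 / 120 - t ^ 3 / 5040 + t ^ 4 / 362880 <
      1007 / 1000 * (1 + (1 - t / 2 + t ^ 2 / 24 - t ^ 3 / 720 + t ^ 4 / 40320 - t ^ 5 /
      3628800) - (1 + Q + Q ^ 2 / 2 + Q ^ 3 / 6 + Q ^ 4 / 24)) := by
  have hs : 0 < 121 / 100 - t := sub_pos.2 hT
  refine sub_pos.1 ?_
  calc
    0 < (70000000000000 / 45949729863572161 * (121 / 100 - t) ^ 8 +
      1637650000000000 / 137849189590716483 * t * (121 / 100 - t) ^ 7 +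
      5586112175000000 / 137849189590716483 * t ^ 2 * (121 / 100 - t) ^ 6 +
      2032914928910875000 / 26053496832645415287 * t ^ 3 * (121 / 100 - t) ^ 5 +
      28665163970110092125 / 312641961991744983444 * t ^ 4 * (121 / 100 - t) ^ 4 +
      498291254585157114965 / 7503407087801879602656 * t ^ 5 * (121 / 100 - t) ^ 3 +
      15957496922341834600693 / 562755531585140970199200 * t ^ 6 * (121 / 100 - t) ^ 2 +
      264123437504495696443103 / 42206664868885572764940000 * t ^ 7 * (121 / 100 - t) +
      15364607725070643825526861 / 31654998651664179573705000000 * t ^ 8) := by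
      positivity
    _ = _ := by
      rw [hQ]
      ring

lemma cos_poly_lt_upper_poly_mul_sin_poly {t Q : ℝ} (h0 : 0 < t) (hT : t < 121 / 100)
    (hQ : Q = -t / 3 - t ^ 2 / 45) :
    1 - t / 2 + t ^ 2 / 24 - t ^ 3 / 720 + t ^ 4 / 40320 <
      (1 + Q) * (1 - t / 6 + t ^ 2 / 120 - t ^ 3 / 5040) := by
  have hs : 0 < 121 / 100 - t := sub_pos.2 hT
  refine sub_pos.1 ?_
  calc
    0 < t ^ 3 * (4000 / 2767149 * (121 / 100 - t) ^ 2 +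
      245473 / 88548768 * t * (121 / 100 - t) +
      8839757 / 6641157600 * t ^ 2) := by
      positivity
    _ = _ := by
      rw [hQ]
      ring

lemma exp_poly_slope_lt {y W : ℝ} (h0 : 0 < y) (hT : y < 1 / 2)
    (hW : W = (15708 / 10000 - y) * (y + 2 * y ^ 3 / 5)) :
    36788 / 100000 * ((1 + W + W ^ 2 / 2 + W ^ 3 / 6 + 5 * W ^ 4 / 96) - (1 - y ^ 2 / 2)) <
      y - y ^ 3 / 6 + y ^ 2 / 2 - y ^ 4 / 24 := by
  have hs : 0 < 1 / 2 - y := sub_pos.2 hT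
  refine sub_pos.1 ?_
  calc
    0 < y * (27016582144 / 1953125 * (1 / 2 - y) ^ 15 +
      257882139979968 / 1220703125 * y * (1 / 2 - y) ^ 14 +
      3444020429782426792 / 2288818359375 * y ^ 2 * (1 / 2 - y) ^ 13 +
      10116982228738058517841 / 1525878906250000 * y ^ 3 * (1 / 2 - y) ^ 12 +
      7710256228856303368373 / 381469726562500 * y ^ 4 * (1 / 2 - y) ^ 11 +
      86123272078333656344303 / 1907348632812500 * y ^ 5 * (1 / 2 - y) ^ 10 +
      43697750170787408145209 / 572204589843750 * y ^ 6 * (1 / 2 - y) ^ 9 +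
      22790562317468365592033519 / 228881835937500000 * y ^ 7 * (1 / 2 - y) ^ 8 +
      721836983631693245441336 / 7152557373046875 * y ^ 8 * (1 / 2 - y) ^ 7 +
      90994882313089514154539183 / 1144409179687500000 * y ^ 9 * (1 / 2 - y) ^ 6 +
      27640154506277112853004029 / 572204589843750000 * y ^ 10 * (1 / 2 - y) ^ 5 +
      1017296128263302148297611323 / 45776367187500000000 * y ^ 11 * (1 / 2 - y) ^ 4 +
      85780010699455263295333073 / 11444091796875000000 * y ^ 12 * (1 / 2 - y) ^ 3 +
      40053664373567233277659669 / 22888183593750000000 * y ^ 13 * (1 / 2 - y) ^ 2 +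
      2894296747729443099199253 / 11444091796875000000 * y ^ 14 * (1 / 2 - y) +
      260288785866665261176081 / 15258789062500000000 * y ^ 15) := by
      positivity
    _ = _ := by
      rw [hW]
      ring

lemma endpoint_poly_lt {y W : ℝ} (h0 : 0 < y) (hT : y < 1 / 2)
    (hW : W = (15708 / 10000 - y) * (y + 2 * y ^ 3 / 5)) :
    36788 / 100000 * ((15707 / 10000 - y) * (1 + W + W ^ 2 / 2 + W ^ 3 / 6 + 5 * W ^ 4 / 96)
      - 15707 / 10000 * (1 - y ^ 2 / 2)) <
      (15707 / 10000 - y) * (1 + y - y ^ 3 / 6) - 15707 / 10000 * (1 - y ^ 2 / 2 + y ^ 4 / 24) := by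
  have hs : 0 < 1 / 2 - y := sub_pos.2 hT
  refine sub_pos.1 ?_
  calc
    0 < y * (2474081966976 / 1220703125 * (1 / 2 - y) ^ 16 +
      23222295412529672 / 762939453125 * y * (1 / 2 - y) ^ 15 +
      305104409628490337743 / 1430511474609375 * y ^ 2 * (1 / 2 - y) ^ 14 +
      7050362694575647581024587 / 7629394531250000000 * y ^ 3 * (1 / 2 - y) ^ 13 +
      63321562459046661735987293 / 22888183593750000000 * y ^ 4 * (1 / 2 - y) ^ 12 +
      1805486968631529407056743 / 298023223876953125 * y ^ 5 * (1 / 2 - y) ^ 11 +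
      286668454253733572803334293 / 28610229492187500000 * y ^ 6 * (1 / 2 - y) ^ 10 +
      14582260251923929958371588133 / 1144409179687500000000 * y ^ 7 * (1 / 2 - y) ^ 9 +
      14376786481529976190608953597 / 1144409179687500000000 * y ^ 8 * (1 / 2 - y) ^ 8 +
      54974057390823331455808475701 / 5722045898437500000000 * y ^ 9 * (1 / 2 - y) ^ 7 +
      32392081711438651216919599387 / 5722045898437500000000 * y ^ 10 * (1 / 2 - y) ^ 6 +
      579501580528410628679712130601 / 228881835937500000000000 * y ^ 11 * (1 / 2 - y) ^ 5 +
      38354889008110276828342149161 / 45776367187500000000000 * y ^ 12 * (1 / 2 - y) ^ 4 +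
      1501742028917036086564189747 / 7629394531250000000000 * y ^ 13 * (1 / 2 - y) ^ 3 +
      140267899238283688885896389 / 4577636718750000000000 * y ^ 14 * (1 / 2 - y) ^ 2 +
      42507266038648188292248019 / 15258789062500000000000 * y ^ 15 * (1 / 2 - y) +
      25098590823154854236897801 / 228881835937500000000000 * y ^ 16) := by
      positivity
    _ = _ := by
      rw [hW]
      ring

section MainBounds

variable {x : ℝ}

lemma one_add_cos_sub_exp_lt_sinc (h0 : 0 < x) (h1 : x < π / 2) :
    1 + cos x - exp (x / tan x - 1) < sin x / x := by
  obtain ⟨t, ht⟩ : ∃ t, t = x ^ 2 := ⟨_, rfl⟩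
  have ht0 : 0 < t := by rw [ht]; positivity
  have hx : x < 1.5708 := by linarith [pi_lt_d4]
  have htT : t < 5 / 2 := by rw [ht]; nlinarith
  have hsin : 0 < sin x := sin_pos_of_pos_of_lt_pi h0 (by linarith [pi_pos])
  have hcos : 0 < cos x := cos_pos_of_mem_Ioo ⟨by linarith [pi_pos], h1⟩
  have hu : x / tan x = x * cos x / sin x := by
    rw [tan_eq_sin_div_cos, div_div_eq_mul_div]
  obtain ⟨P, hPt⟩ : ∃ P, P = -t / 3 - t ^ 2 / 45 - t ^ 3 / 450 - 3 * t ^ 4 / 10000 := ⟨_, rfl⟩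
  have hP : P ≤ x / tan x - 1 := by
    have hpoly := lower_poly_mul_sin_poly_lt_cos_poly ht0 htT hPt
    have hS := sin_le_taylor h0.le ht
    have hC := taylor_le_cos h0.le ht
    rw [hu, le_sub_iff_add_le, le_div_iff₀ hsin]
    rcases le_total (1 + P) 0 with hneg | hnonneg
    · nlinarith [mul_pos h0 hcos]
    · calc (P + 1) * sin x = (1 + P) * sin x := by ring
        _ ≤ (1 + P) * (x * _) := mul_le_mul_of_nonneg_left hS hnonneg
        _ = x * ((1 + P) * _) := by ring
        _ ≤ x * cos x := mul_le_mul_of_nonneg_left (hpoly.le.trans hC) h0.le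
  have hPneg : P ≤ 0 := by
    have : 0 < t / 3 + t ^ 2 / 45 + t ^ 3 / 450 + 3 * t ^ 4 / 10000 := by positivity
    linarith
  have hexp := (quintic_le_exp_of_nonpos hPneg).trans (exp_le_exp.2 hP)
  have hpoly := one_add_cos_sub_sinc_poly_lt_exp_poly ht0 htT hPt
  have hsinc := (le_div_iff₀' h0).2 (taylor_le_sin h0.le ht)
  linarith [cos_le_taylor h0.le ht]

lemma sinc_lt_mul_of_lt (h0 : 0 < x) (h1 : x < 11 / 10) :
    sin x / x < 1007 / 1000 * (1 + cos x - exp (x / tan x - 1)) := by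
  obtain ⟨t, ht⟩ : ∃ t, t = x ^ 2 := ⟨_, rfl⟩
  have ht0 : 0 < t := by rw [ht]; positivity
  have htT : t < 121 / 100 := by rw [ht]; nlinarith
  have hsin : 0 < sin x := sin_pos_of_pos_of_le_two h0 (by linarith)
  obtain ⟨Q, hQt⟩ : ∃ Q, Q = -t / 3 - t ^ 2 / 45 := ⟨_, rfl⟩
  have hQ : x / tan x - 1 ≤ Q := by
    have hpoly := cos_poly_lt_upper_poly_mul_sin_poly ht0 htT hQt
    have hS := taylor_le_sin h0.le ht
    have hC := cos_le_taylor h0.le ht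
    have hnonneg : 0 ≤ 1 + Q := by nlinarith
    rw [tan_eq_sin_div_cos, div_div_eq_mul_div, sub_le_iff_le_add, div_le_iff₀ hsin]
    calc x * cos x ≤ x * ((1 + Q) * _) := mul_le_mul_of_nonneg_left (hC.trans hpoly.le) h0.le
      _ = (1 + Q) * (x * _) := by ring
      _ ≤ (1 + Q) * sin x := mul_le_mul_of_nonneg_left hS hnonneg
      _ = (Q + 1) * sin x := by ring
  have hQneg : Q ≤ 0 := by nlinarith
  have hexp := (exp_le_exp.2 hQ).trans (exp_le_quartic_of_nonpos hQneg)
  have hpoly := sinc_poly_lt_mul_sub_exp_poly ht0 htT hQt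
  have hsinc := (div_le_iff₀' h0).2 (sin_le_taylor h0.le ht)
  linarith [taylor_le_cos h0.le ht]

lemma tan_le_cubic (h0 : 0 < x) (h1 : x < 1 / 2) : tan x ≤ x + 2 * x ^ 3 / 5 := by
  have hcos : 0 < cos x := cos_pos_of_le_one (abs_le.2 ⟨by linarith, by linarith⟩)
  rw [tan_eq_sin_div_cos, div_le_iff₀ hcos]
  have hsq : x ^ 2 < 1 / 4 := by nlinarith
  have h3 : 0 < x ^ 3 := by positivity
  calc sin x ≤ x - x ^ 3 / 6 + x ^ 5 / 120 := sin_le_quintic h0.le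
    _ ≤ (x + 2 * x ^ 3 / 5) * (1 - x ^ 2 / 2) := by nlinarith [mul_pos h3 (sub_pos.2 hsq)]
    _ ≤ (x + 2 * x ^ 3 / 5) * cos x :=
      mul_le_mul_of_nonneg_left one_sub_sq_div_two_le_cos (by positivity)

lemma inv_exp_one_mul_sub_lt {y : ℝ} (h0 : 0 < y) (h1 : y < 1 / 2) :
    exp (-1) * ((π / 2 - y) * exp ((π / 2 - y) * tan y) - π / 2 * cos y) <
      (π / 2 - y) * (1 + sin y) - π / 2 * cos y := by
  have hp1 : 15707 / 10000 < π / 2 := by linarith [pi_gt_d4]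
  have hp2 : π / 2 < 15708 / 10000 := by linarith [pi_lt_d4]
  have htan := tan_le_cubic h0 h1
  have hpy : 0 < π / 2 - y := by linarith
  have hytan : y ≤ tan y := (lt_tan h0 (by linarith)).le
  obtain ⟨W, hW⟩ : ∃ W, W = (15708 / 10000 - y) * (y + 2 * y ^ 3 / 5) := ⟨_, rfl⟩
  have hw : (π / 2 - y) * tan y ≤ W := by
    rw [hW]
    exact mul_le_mul (by linarith) htan (h0.le.trans hytan) (by linarith)
  have hW0 : 0 ≤ W := by
    rw [hW]
    exact mul_nonneg (by linarith) (by positivity)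
  have hW1 : W ≤ 1 := by
    have : y + 2 * y ^ 3 / 5 ≤ 6 / 10 := by nlinarith [pow_le_pow_left₀ h0.le h1.le 3]
    rw [hW]
    nlinarith [pow_pos h0 3]
  have hslope := exp_poly_slope_lt h0 h1 hW
  have hend := endpoint_poly_lt h0 h1 hW
  have hexp : exp ((π / 2 - y) * tan y) ≤
      1 + W + W ^ 2 / 2 + W ^ 3 / 6 + 5 * W ^ 4 / 96 := by
    have h := exp_bound' hW0 hW1 (n := 4) (by norm_num)
    norm_num [Finset.sum_range_succ, Nat.factorial] at h
    linarith [exp_le_exp.2 hw]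
  have hnonneg : 0 ≤ (π / 2 - y) * exp ((π / 2 - y) * tan y) - π / 2 * cos y := by
    have h2 : 1 + (π / 2 - y) * y ≤ exp ((π / 2 - y) * tan y) := by
      linarith [add_one_le_exp ((π / 2 - y) * tan y), mul_le_mul_of_nonneg_left hytan hpy.le]
    have h3 : 1 ≤ (π / 2 - y) ^ 2 := one_le_pow₀ (by linarith)
    nlinarith [mul_le_mul_of_nonneg_left h2 hpy.le, mul_le_mul_of_nonneg_left h3 h0.le,
      mul_le_mul_of_nonneg_left (cos_le_one y) pi_div_two_pos.le]
  have hk : exp (-1) ≤ 36788 / 100000 := by linarith [exp_neg_one_lt_d9]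
  have h4 := mul_le_mul_of_nonneg_right hk hnonneg
  have h5 := mul_le_mul_of_nonneg_left hexp hpy.le
  have h6 := mul_le_mul_of_nonneg_left (one_sub_sq_div_two_le_cos (x := y)) pi_div_two_pos.le
  have h7 := mul_le_mul_of_nonneg_left (sub_cube_le_sin h0.le) hpy.le
  have h8 := mul_le_mul_of_nonneg_left (cos_le_quartic h0.le) pi_div_two_pos.le
  have h9 := mul_le_mul_of_nonneg_left hslope.le (sub_pos.2 hp1).le
  linarith

lemma sinc_lt_const_mul_of_gt (h0 : 11 / 10 ≤ x) (h1 : x < π / 2) :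
    sin x / x < 2 * exp 1 / (π * (exp 1 - 1)) * (1 + cos x - exp (x / tan x - 1)) := by
  have hx : 0 < x := by linarith
  have hy := inv_exp_one_mul_sub_lt (y := π / 2 - x) (by linarith) (by linarith [pi_lt_d4])
  rw [sub_sub_cancel, tan_pi_div_two_sub, cos_pi_div_two_sub, sin_pi_div_two_sub,
    ← div_eq_mul_inv] at hy
  have he : 0 < exp 1 - 1 := by linarith [exp_one_gt_two]
  have hinv : exp 1 * exp (-1) = 1 := by rw [← exp_add]; simp
  have hexp : exp (x / tan x - 1) = exp (-1) * exp (x / tan x) := by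
    rw [← exp_add]; ring_nf
  rw [hexp, div_mul_eq_mul_div, div_lt_div_iff₀ hx (mul_pos pi_pos he)]
  have := mul_lt_mul_of_pos_left hy (exp_pos 1)
  linear_combination 2 * this + π * sin x * hinv

lemma const_gt : 1007 / 1000 < 2 * exp 1 / (π * (exp 1 - 1)) := by
  have he : 0 < exp 1 - 1 := by linarith [exp_one_gt_two]
  rw [lt_div_iff₀ (mul_pos pi_pos he)]
  nlinarith [exp_one_lt_d9, exp_one_gt_d9, pi_lt_d4, mul_lt_mul_of_pos_right pi_lt_d4 he]

end MainBounds

theorem stmt_14 (x : ℝ) (hx : x ∈ Set.Ioo 0 (π / 2)) :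
    1 + Real.cos x - Real.exp (x / Real.tan x - 1) < Real.sin x / x ∧
    Real.sin x / x <
      (2 * Real.exp 1 / (π * (Real.exp 1 - 1))) *
        (1 + Real.cos x - Real.exp (x / Real.tan x - 1)) := by
  obtain ⟨h0, h1⟩ := hx
  refine ⟨one_add_cos_sub_exp_lt_sinc h0 h1, ?_⟩
  rcases lt_or_ge x (11 / 10) with h | h
  · have hlt := sinc_lt_mul_of_lt h0 h
    have hsinc : 0 < sin x / x := div_pos (sin_pos_of_pos_of_lt_pi h0 (by linarith [pi_pos])) h0
    refine hlt.trans (mul_lt_mul_of_pos_right const_gt ?_)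
    linarith
  · exact sinc_lt_const_mul_of_gt h h1
end

section
/- For all real numbers a, b > 0 with a ≠ b, one has M_{1/3} < (2G + A)/3, where M_{1/3} = ((a^{1/3} + b^{1/3})/2)^3. -/
open Real

/-- Arithmetic mean -/
noncomputable def Am (a b : ℝ) : ℝ := (a + b) / 2

/-- Geometric mean -/
noncomputable def Gm (a b : ℝ) : ℝ := Real.sqrt (a * b)

/-- Harmonic mean -/
noncomputable def Hm (a b : ℝ) : ℝ := 2 * a * b / (a + b)

/-- Seiffert mean -/
noncomputable def Pm (a b : ℝ) : ℝ := (a - b) / (2 * Real.arcsin ((a - b) / (a + b)))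

/-- Sándor's X mean -/
noncomputable def Xm (a b : ℝ) : ℝ := Am a b * Real.exp (Gm a b / Pm a b - 1)

/-- Logarithmic mean -/
noncomputable def Lm (a b : ℝ) : ℝ := (a - b) / (Real.log a - Real.log b)

/-- Identric mean -/
noncomputable def Im (a b : ℝ) : ℝ := (1 / Real.exp 1) * ((a ^ a) / (b ^ b)) ^ (1 / (a - b))

/-- Power mean -/
noncomputable def Mp (p a b : ℝ) : ℝ :=
  if p = 0 then Real.sqrt (a * b) else ((a ^ p + b ^ p) / 2) ^ (1 / p)

/-- Power-type Heronian mean -/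
noncomputable def Hp (p a b : ℝ) : ℝ :=
  if p = 0 then Real.sqrt (a * b) else ((a ^ p + (a * b) ^ (p / 2) + b ^ p) / 3) ^ (1 / p)

/-- The power mean inequality in the sixth roots `x = a ^ (1/6)`, `y = b ^ (1/6)`. -/
theorem cube_half_sq_add_sq_lt {x y : ℝ} (hx : 0 < x) (hy : 0 < y) (hxy : x ≠ y) :
    ((x ^ 2 + y ^ 2) / 2) ^ 3 < (2 * (x ^ 3 * y ^ 3) + (x ^ 6 + y ^ 6) / 2) / 3 := by
  have h : 0 < (x - y) ^ 4 * (x ^ 2 + 4 * x * y + y ^ 2) :=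
    mul_pos (Even.pow_pos (by decide) (sub_ne_zero.mpr hxy)) (by positivity)
  linear_combination h / 24

theorem stmt_15 (a b : ℝ) (ha : 0 < a) (hb : 0 < b) (hab : a ≠ b) :
    Mp (1 / 3) a b < (2 * Gm a b + Am a b) / 3 := by
  obtain ⟨x, hx, rfl⟩ : ∃ x : ℝ, 0 < x ∧ x ^ 6 = a :=
    ⟨a ^ (1 / 6 : ℝ), by positivity, by rw [← rpow_mul_natCast ha.le]; norm_num⟩
  obtain ⟨y, hy, rfl⟩ : ∃ y : ℝ, 0 < y ∧ y ^ 6 = b :=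
    ⟨b ^ (1 / 6 : ℝ), by positivity, by rw [← rpow_mul_natCast hb.le]; norm_num⟩
  have cbrt {z : ℝ} (hz : 0 < z) : (z ^ 6) ^ (1 / 3 : ℝ) = z ^ 2 := by
    rw [← rpow_natCast z 6, ← rpow_mul hz.le, ← rpow_natCast z 2]
    norm_num
  have hG : Gm (x ^ 6) (y ^ 6) = x ^ 3 * y ^ 3 := by
    rw [Gm, show x ^ 6 * y ^ 6 = (x ^ 3 * y ^ 3) ^ 2 by ring, sqrt_sq (by positivity)]
  have hM : Mp (1 / 3) (x ^ 6) (y ^ 6) = ((x ^ 2 + y ^ 2) / 2) ^ 3 := by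
    rw [Mp, if_neg (by norm_num), cbrt hx, cbrt hy, one_div_one_div, rpow_ofNat]
  rw [hM, hG, Am]
  exact cube_half_sq_add_sq_lt hx hy fun h => hab (by rw [h])
end

section
/- For all real numbers a, b > 0 with a ≠ b, one has H_{1/2} < (2G + A)/3, where H_{1/2} = ((√a + (ab)^{1/4} + √b)/3)^2. -/
open Real

theorem stmt_16 (a b : ℝ) (ha : 0 < a) (hb : 0 < b) (hab : a ≠ b) :
    Hp (1 / 2) a b < (2 * Gm a b + Am a b) / 3 := by
  obtain ⟨x, hx, rfl⟩ : ∃ x : ℝ, 0 < x ∧ x ^ 4 = a :=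
    ⟨a ^ (1 / 4 : ℝ), by positivity, by rw [← rpow_natCast, ← rpow_mul ha.le]; norm_num⟩
  obtain ⟨y, hy, rfl⟩ : ∃ y : ℝ, 0 < y ∧ y ^ 4 = b :=
    ⟨b ^ (1 / 4 : ℝ), by positivity, by rw [← rpow_natCast, ← rpow_mul hb.le]; norm_num⟩
  have hne : x - y ≠ 0 := fun h => hab (by rw [sub_eq_zero.mp h])
  have half (z : ℝ) (hz : 0 < z) : (z ^ 4) ^ (1 / 2 : ℝ) = z ^ 2 := by
    rw [← rpow_natCast, ← rpow_mul hz.le, ← rpow_natCast]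
    norm_num
  have quarter : (x ^ 4 * y ^ 4) ^ ((1 / 2 : ℝ) / 2) = x * y := by
    rw [← mul_pow, ← rpow_natCast, ← rpow_mul (by positivity)]
    norm_num
  have hG : Gm (x ^ 4) (y ^ 4) = x ^ 2 * y ^ 2 := by
    rw [Gm, show x ^ 4 * y ^ 4 = (x ^ 2 * y ^ 2) ^ 2 by ring, sqrt_sq (by positivity)]
  have hH : Hp (1 / 2) (x ^ 4) (y ^ 4) = ((x ^ 2 + x * y + y ^ 2) / 3) ^ 2 := by
    rw [Hp, if_neg (by norm_num), half x hx, half y hy, quarter, ← rpow_natCast _ 2]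
    norm_num
  rw [hH, hG, Am]
  have : 0 < (x - y) ^ 4 := by positivity
  linarith
end

section
/- For all real numbers a, b > 0 with a ≠ b, one has the two chains of inequalities: (1) P·X > P·L > A·G, and (2) I·L > P·L > A·G. -/
open Real

/-- A function with positive derivative on `(0, r)` and limit `0` at `0` is positive there. -/
theorem pos_of_hasDerivAt_pos_of_tendsto_zero {f f' : ℝ → ℝ} {r : ℝ}
    (hf : ∀ x ∈ Set.Ioo 0 r, HasDerivAt f (f' x) x) (hf' : ∀ x ∈ Set.Ioo 0 r, 0 < f' x)
    (h0 : Filter.Tendsto f (nhdsWithin 0 (Set.Ioi 0)) (nhds 0)) {x : ℝ} (hx : x ∈ Set.Ioo 0 r) :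
    0 < f x := by
  have hmono : StrictMonoOn f (Set.Ioo 0 r) := by
    refine strictMonoOn_of_deriv_pos (convex_Ioo 0 r)
      (fun y hy => (hf y hy).continuousAt.continuousWithinAt) fun y hy => ?_
    rw [interior_Ioo] at hy
    rw [(hf y hy).deriv]
    exact hf' y hy
  have hx2 : x / 2 ∈ Set.Ioo 0 r := ⟨by linarith [hx.1], by linarith [hx.1, hx.2]⟩
  have hle : 0 ≤ f (x / 2) := by
    refine le_of_tendsto h0 ?_
    filter_upwards [Ioo_mem_nhdsGT hx2.1] with y hy
    exact (hmono ⟨hy.1, hy.2.trans hx2.2⟩ hx2 hy.2).le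
  exact hle.trans_lt (hmono hx2 hx (by linarith [hx.1]))

/-- The inverse Gudermannian function, `artanh (sin x)`. -/
noncomputable def invGudermannian (x : ℝ) : ℝ := (Real.log (1 + sin x) - Real.log (1 - sin x)) / 2

theorem sin_mem_Ioo_of_mem_Ioo {x : ℝ} (hx : x ∈ Set.Ioo 0 (π / 2)) : sin x ∈ Set.Ioo 0 1 := by
  refine ⟨sin_pos_of_pos_of_lt_pi hx.1 (by linarith [hx.2, pi_pos]), ?_⟩
  rw [← sin_pi_div_two]
  exact sin_lt_sin_of_lt_of_le_pi_div_two (by linarith [hx.1, pi_pos]) le_rfl hx.2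

theorem cos_pos_of_mem_Ioo_zero {x : ℝ} (hx : x ∈ Set.Ioo 0 (π / 2)) : 0 < cos x :=
  cos_pos_of_mem_Ioo ⟨by linarith [hx.1, pi_pos], hx.2⟩

theorem hasDerivAt_invGudermannian {x : ℝ} (hx : 0 < cos x) :
    HasDerivAt invGudermannian (1 / cos x) x := by
  have hsq := sin_sq_add_cos_sq x
  have h1 : 0 < 1 + sin x := by nlinarith [pow_pos hx 2, neg_one_le_sin x]
  have h2 : 0 < 1 - sin x := by nlinarith [pow_pos hx 2, sin_le_one x]
  have h := ((((hasDerivAt_sin x).const_add 1).log h1.ne').sub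
    (((hasDerivAt_sin x).const_sub 1).log h2.ne')).div_const 2
  refine h.congr_deriv ?_
  field_simp
  linear_combination 2 * hsq

theorem invGudermannian_zero : invGudermannian 0 = 0 := by simp [invGudermannian]

theorem invGudermannian_pos {x : ℝ} (hx : x ∈ Set.Ioo 0 (π / 2)) : 0 < invGudermannian x := by
  have hs := sin_mem_Ioo_of_mem_Ioo hx
  have := Real.log_lt_log (by linarith [hs.2] : 0 < 1 - sin x)
    (by linarith [hs.1] : 1 - sin x < 1 + sin x)
  unfold invGudermannian
  linarith

theorem tendsto_div_self_nhdsGT_zero {f : ℝ → ℝ} {f' : ℝ} (hf : HasDerivAt f f' 0) (h0 : f 0 = 0) :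
    Filter.Tendsto (fun x => f x / x) (nhdsWithin 0 (Set.Ioi 0)) (nhds f') := by
  refine (hf.tendsto_slope_zero_right).congr fun x => ?_
  simp [h0, div_eq_inv_mul]

theorem tendsto_sin_div_self :
    Filter.Tendsto (fun x => sin x / x) (nhdsWithin 0 (Set.Ioi 0)) (nhds 1) :=
  tendsto_div_self_nhdsGT_zero (by simpa using hasDerivAt_sin 0) sin_zero

theorem tendsto_invGudermannian_div_self :
    Filter.Tendsto (fun x => invGudermannian x / x) (nhdsWithin 0 (Set.Ioi 0)) (nhds 1) :=
  tendsto_div_self_nhdsGT_zero (by simpa using hasDerivAt_invGudermannian (x := 0) (by simp))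
    invGudermannian_zero

theorem tendsto_invGudermannian_div_sin :
    Filter.Tendsto (fun x => invGudermannian x / sin x) (nhdsWithin 0 (Set.Ioi 0)) (nhds 1) := by
  have h := tendsto_invGudermannian_div_self.div tendsto_sin_div_self one_ne_zero
  rw [div_one] at h
  refine h.congr' ?_
  filter_upwards [self_mem_nhdsWithin] with x hx
  exact div_div_div_cancel_right₀ (ne_of_gt hx) _ _

theorem tendsto_cos_nhdsGT_zero :
    Filter.Tendsto cos (nhdsWithin 0 (Set.Ioi 0)) (nhds 1) := by
  simpa using (continuous_cos.tendsto 0).mono_left nhdsWithin_le_nhds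

/-- Trigonometric form of `A * G < P * L`. -/
theorem mul_cos_mul_invGudermannian_lt_sin_sq {x : ℝ} (hx : x ∈ Set.Ioo 0 (π / 2)) :
    x * cos x * invGudermannian x < sin x ^ 2 := by
  have key : 0 < sin x ^ 2 / (x * cos x) - invGudermannian x := by
    refine pos_of_hasDerivAt_pos_of_tendsto_zero
      (f := fun y => sin y ^ 2 / (y * cos y) - invGudermannian y)
      (f' := fun y => (sin y - y * cos y) * (y - sin y * cos y) / (y * cos y) ^ 2)
      (fun y hy => ?_) (fun y hy => ?_) ?_ hx
    · have hc := cos_pos_of_mem_Ioo_zero hy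
      have hy0 := hy.1
      have h := (((hasDerivAt_sin y).pow 2).div ((hasDerivAt_id y).mul (hasDerivAt_cos y))
        (mul_pos hy0 hc).ne').sub (hasDerivAt_invGudermannian hc)
      refine h.congr_deriv ?_
      simp only [Pi.pow_apply, Pi.mul_apply, id_eq]
      field_simp
      have hsq := sin_sq_add_cos_sq y
      push_cast
      linear_combination (y * sin y) * hsq
    · have hc := cos_pos_of_mem_Ioo_zero hy
      have hs := sin_mem_Ioo_of_mem_Ioo hy
      have htan := Real.lt_tan hy.1 hy.2
      rw [tan_eq_sin_div_cos, lt_div_iff₀ hc] at htan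
      have hsin := Real.sin_lt hy.1
      have hcos := cos_le_one y
      have hy0 := hy.1
      exact div_pos (mul_pos (by linarith) (by nlinarith [hs.1])) (by positivity)
    · have h1 := (tendsto_sin_div_self.mul ((continuous_sin.tendsto 0).mono_left
        nhdsWithin_le_nhds)).div tendsto_cos_nhdsGT_zero one_ne_zero
      have h2 : Filter.Tendsto invGudermannian (nhdsWithin 0 (Set.Ioi 0)) (nhds 0) := by
        have := (hasDerivAt_invGudermannian (x := 0) (by simp)).continuousAt.tendsto
        rw [invGudermannian_zero] at this
        exact this.mono_left nhdsWithin_le_nhds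
      have h := h1.sub h2
      simp only [sin_zero, mul_zero, zero_div, sub_zero] at h
      refine h.congr fun y => ?_
      simp only [Pi.div_apply]
      congr 1
      rw [div_mul_eq_mul_div, div_div, sq]
  have hpos := mul_pos hx.1 (cos_pos_of_mem_Ioo_zero hx)
  rw [sub_pos, lt_div_iff₀ hpos] at key
  linarith

/-- Trigonometric form of `L < X`. -/
theorem log_invGudermannian_div_sin_pos {x : ℝ} (hx : x ∈ Set.Ioo 0 (π / 2)) :
    0 < Real.log (invGudermannian x / sin x) + cos x / (sin x / x) - 1 := by
  refine pos_of_hasDerivAt_pos_of_tendsto_zero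
    (f := fun y => Real.log (invGudermannian y / sin y) + cos y / (sin y / y) - 1)
    (f' := fun y => (sin y ^ 2 - y * cos y * invGudermannian y) /
      (sin y ^ 2 * cos y * invGudermannian y)) (fun y hy => ?_) (fun y hy => ?_) ?_ hx
  · have hc := cos_pos_of_mem_Ioo_zero hy
    have hs := (sin_mem_Ioo_of_mem_Ioo hy).1
    have hT := invGudermannian_pos hy
    have hy0 := hy.1
    have h := ((((hasDerivAt_invGudermannian hc).div (hasDerivAt_sin y) hs.ne').log
      (div_pos hT hs).ne').add ((hasDerivAt_cos y).div
        ((hasDerivAt_sin y).div (hasDerivAt_id y) hy0.ne') (div_pos hs hy0).ne')).sub_const 1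
    refine h.congr_deriv ?_
    simp only [Pi.div_apply, id_eq]
    field_simp
    have hsq := sin_sq_add_cos_sq y
    linear_combination (-(y * cos y * invGudermannian y)) * hsq
  · have hc := cos_pos_of_mem_Ioo_zero hy
    have hs := (sin_mem_Ioo_of_mem_Ioo hy).1
    have hT := invGudermannian_pos hy
    exact div_pos (sub_pos.2 (mul_cos_mul_invGudermannian_lt_sin_sq hy)) (by positivity)
  · have h := ((tendsto_invGudermannian_div_sin.log one_ne_zero).add
      (tendsto_cos_nhdsGT_zero.div tendsto_sin_div_self one_ne_zero)).sub_const 1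
    simpa using h

/-- Trigonometric form of `P < I`. -/
theorem invGudermannian_div_sin_add_log_cos_pos {x : ℝ} (hx : x ∈ Set.Ioo 0 (π / 2)) :
    0 < invGudermannian x / sin x + Real.log (cos x) - Real.log (sin x / x) - 1 := by
  refine pos_of_hasDerivAt_pos_of_tendsto_zero
    (f := fun y => invGudermannian y / sin y + Real.log (cos y) - Real.log (sin y / y) - 1)
    (f' := fun y => (sin y ^ 2 - y * cos y * invGudermannian y) / (sin y ^ 2 * y))
    (fun y hy => ?_) (fun y hy => ?_) ?_ hx
  · have hc := cos_pos_of_mem_Ioo_zero hy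
    have hs := (sin_mem_Ioo_of_mem_Ioo hy).1
    have hy0 := hy.1
    have h := ((((hasDerivAt_invGudermannian hc).div (hasDerivAt_sin y) hs.ne').add
      ((hasDerivAt_cos y).log hc.ne')).sub
        (((hasDerivAt_sin y).div (hasDerivAt_id y) hy0.ne').log (div_pos hs hy0).ne')).sub_const 1
    refine h.congr_deriv ?_
    simp only [Pi.div_apply, id_eq]
    field_simp
    have hsq := sin_sq_add_cos_sq y
    linear_combination (-(y * sin y)) * hsq
  · have hs := (sin_mem_Ioo_of_mem_Ioo hy).1
    have hy0 := hy.1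
    exact div_pos (sub_pos.2 (mul_cos_mul_invGudermannian_lt_sin_sq hy)) (by positivity)
  · have h := ((tendsto_invGudermannian_div_sin.add (tendsto_cos_nhdsGT_zero.log one_ne_zero)).sub
      (tendsto_sin_div_self.log one_ne_zero)).sub_const 1
    simpa using h

theorem Am_comm (a b : ℝ) : Am a b = Am b a := by rw [Am, Am, add_comm]

theorem Gm_comm (a b : ℝ) : Gm a b = Gm b a := by rw [Gm, Gm, mul_comm]

theorem Pm_comm (a b : ℝ) : Pm a b = Pm b a := by
  rw [Pm, Pm, ← neg_sub b a, add_comm a b, neg_div (b + a), arcsin_neg, mul_neg, neg_div_neg_eq]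

theorem Lm_comm (a b : ℝ) : Lm a b = Lm b a := by
  rw [Lm, Lm, ← neg_sub b a, ← neg_sub (Real.log b), neg_div_neg_eq]

theorem Xm_comm (a b : ℝ) : Xm a b = Xm b a := by
  rw [Xm, Xm, Am_comm, Gm_comm, Pm_comm]

theorem Im_comm {a b : ℝ} (ha : 0 < a) (hb : 0 < b) : Im a b = Im b a := by
  have h : 1 / (a - b) = -(1 / (b - a)) := by rw [← neg_sub b a, div_neg]
  rw [Im, Im, h, ← inv_div (b ^ b), rpow_neg (by positivity), inv_rpow (by positivity), inv_inv]

section Parametrization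

variable {m x : ℝ}

theorem Am_param : Am (m * (1 + sin x)) (m * (1 - sin x)) = m := by
  rw [Am]; ring

theorem Gm_param (hm : 0 < m) (hx : x ∈ Set.Ioo 0 (π / 2)) :
    Gm (m * (1 + sin x)) (m * (1 - sin x)) = m * cos x := by
  have hc := cos_pos_of_mem_Ioo_zero hx
  rw [Gm, ← Real.sqrt_sq (mul_pos hm hc).le]
  congr 1
  linear_combination (-m ^ 2) * sin_sq_add_cos_sq x

theorem Pm_param (hm : 0 < m) (hx : x ∈ Set.Ioo 0 (π / 2)) :
    Pm (m * (1 + sin x)) (m * (1 - sin x)) = m * (sin x / x) := by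
  have h : (m * (1 + sin x) - m * (1 - sin x)) / (m * (1 + sin x) + m * (1 - sin x)) = sin x := by
    rw [div_eq_iff (by ring_nf; positivity)]
    ring
  have hx0 := hx.1
  rw [Pm, h, arcsin_sin (by linarith [pi_pos]) hx.2.le]
  field_simp
  ring

theorem log_sub_log_param (hm : 0 < m) (hx : x ∈ Set.Ioo 0 (π / 2)) :
    Real.log (m * (1 + sin x)) - Real.log (m * (1 - sin x)) = 2 * invGudermannian x := by
  have hs := sin_mem_Ioo_of_mem_Ioo hx
  rw [Real.log_mul hm.ne' (by linarith [hs.1]), Real.log_mul hm.ne' (by linarith [hs.2]),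
    invGudermannian]
  ring

theorem Lm_param (hm : 0 < m) (hx : x ∈ Set.Ioo 0 (π / 2)) :
    Lm (m * (1 + sin x)) (m * (1 - sin x)) = m * (sin x / invGudermannian x) := by
  have hT := invGudermannian_pos hx
  rw [Lm, log_sub_log_param hm hx]
  field_simp
  ring

theorem Xm_param (hm : 0 < m) (hx : x ∈ Set.Ioo 0 (π / 2)) :
    Xm (m * (1 + sin x)) (m * (1 - sin x)) = m * Real.exp (cos x / (sin x / x) - 1) := by
  rw [Xm, Am_param, Gm_param hm hx, Pm_param hm hx, mul_div_mul_left _ _ hm.ne']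

theorem Im_param (hm : 0 < m) (hx : x ∈ Set.Ioo 0 (π / 2)) :
    Im (m * (1 + sin x)) (m * (1 - sin x)) =
      m * Real.exp (invGudermannian x / sin x + Real.log (cos x) - 1) := by
  have hs := sin_mem_Ioo_of_mem_Ioo hx
  have hc := cos_pos_of_mem_Ioo_zero hx
  have hs0 := hs.1
  have h1 : 0 < 1 + sin x := by linarith
  have h2 : 0 < 1 - sin x := by linarith [hs.2]
  have hcos : 2 * Real.log (cos x) = Real.log (1 + sin x) + Real.log (1 - sin x) := by
    rw [← Real.log_mul h1.ne' h2.ne']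
    have : (1 + sin x) * (1 - sin x) = cos x ^ 2 := by linear_combination -sin_sq_add_cos_sq x
    rw [this, Real.log_pow]
    norm_num
  have hpos : 0 < m * (1 + sin x) := by positivity
  have hneg : 0 < m * (1 - sin x) := by positivity
  rw [Im, rpow_def_of_pos hpos, rpow_def_of_pos hneg, ← Real.exp_sub, ← Real.exp_mul,
    one_div, ← Real.exp_neg, ← Real.exp_add]
  have hexp (z : ℝ) : m * Real.exp z = Real.exp (Real.log m + z) := by
    rw [Real.exp_add, Real.exp_log hm]
  rw [hexp]
  congr 1
  rw [Real.log_mul hm.ne' h1.ne', Real.log_mul hm.ne' h2.ne', invGudermannian]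
  have hd : m * (1 + sin x) - m * (1 - sin x) = 2 * m * sin x := by ring
  rw [hd]
  field_simp
  linear_combination (-sin x) * hcos

end Parametrization

theorem exists_param {a b : ℝ} (hb : 0 < b) (hab : b < a) :
    ∃ m > 0, ∃ x ∈ Set.Ioo 0 (π / 2), a = m * (1 + sin x) ∧ b = m * (1 - sin x) := by
  have hsum : 0 < a + b := by linarith
  have ht0 : 0 < (a - b) / (a + b) := div_pos (by linarith) hsum
  have ht1 : (a - b) / (a + b) < 1 := by rw [div_lt_one hsum]; linarith
  refine ⟨(a + b) / 2, by linarith, arcsin ((a - b) / (a + b)),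
    ⟨arcsin_pos.2 ht0, arcsin_lt_pi_div_two.2 ht1⟩, ?_⟩
  rw [sin_arcsin (by linarith) ht1.le]
  constructor <;> field_simp <;> ring

theorem mean_inequalities_param {m x : ℝ} (hm : 0 < m) (hx : x ∈ Set.Ioo 0 (π / 2)) {a b : ℝ}
    (ha : a = m * (1 + sin x)) (hb : b = m * (1 - sin x)) :
    Pm a b * Lm a b < Pm a b * Xm a b ∧ Am a b * Gm a b < Pm a b * Lm a b ∧
      Pm a b * Lm a b < Im a b * Lm a b := by
  have hs := (sin_mem_Ioo_of_mem_Ioo hx).1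
  have hT := invGudermannian_pos hx
  have hx0 := hx.1
  rw [ha, hb, Am_param, Gm_param hm hx, Pm_param hm hx, Lm_param hm hx, Xm_param hm hx,
    Im_param hm hx]
  refine ⟨?_, ?_, ?_⟩
  · have h : sin x / invGudermannian x < Real.exp (cos x / (sin x / x) - 1) := by
      rw [← Real.log_lt_iff_lt_exp (by positivity), ← inv_div, Real.log_inv]
      linarith [log_invGudermannian_div_sin_pos hx]
    gcongr
  · have h : cos x < sin x / x * (sin x / invGudermannian x) := by
      rw [div_mul_div_comm, lt_div_iff₀ (by positivity)]
      linarith [mul_cos_mul_invGudermannian_lt_sin_sq hx]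
    nlinarith [mul_lt_mul_of_pos_left h (mul_pos hm hm)]
  · have h : sin x / x < Real.exp (invGudermannian x / sin x + Real.log (cos x) - 1) := by
      rw [← Real.log_lt_iff_lt_exp (by positivity)]
      linarith [invGudermannian_div_sin_add_log_cos_pos hx]
    gcongr

theorem stmt_17 (a b : ℝ) (ha : 0 < a) (hb : 0 < b) (hab : a ≠ b) :
    (Pm a b * Xm a b > Pm a b * Lm a b ∧ Pm a b * Lm a b > Am a b * Gm a b) ∧
    (Im a b * Lm a b > Pm a b * Lm a b ∧ Pm a b * Lm a b > Am a b * Gm a b) := by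
  rcases hab.lt_or_gt with h | h
  · obtain ⟨m, hm, x, hx, h1, h2⟩ := exists_param ha h
    obtain ⟨hX, hG, hI⟩ := mean_inequalities_param hm hx h1 h2
    rw [Pm_comm a, Xm_comm a, Lm_comm a, Am_comm a, Gm_comm a, Im_comm ha hb]
    exact ⟨⟨hX, hG⟩, hI, hG⟩
  · obtain ⟨m, hm, x, hx, h1, h2⟩ := exists_param hb h
    obtain ⟨hX, hG, hI⟩ := mean_inequalities_param hm hx h1 h2
    exact ⟨⟨hX, hG⟩, hI, hG⟩
end

section
/- For all real numbers a, b > 0 with a ≠ b, one has I/L < L/G < 1 + G/H − I/G. -/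
open Real

open Filter Topology

/-- A function on `(0, ∞)` with positive derivative and limit `0` at `0` is positive. -/
theorem pos_of_hasDerivAt_pos_of_tendsto_zero_s18 {f f' : ℝ → ℝ}
    (hf : ∀ x, 0 < x → HasDerivAt f (f' x) x) (hf' : ∀ x, 0 < x → 0 < f' x)
    (h0 : Tendsto f (𝓝[>] 0) (𝓝 0)) {t : ℝ} (ht : 0 < t) : 0 < f t := by
  have hmono : StrictMonoOn f (Set.Ioi 0) := by
    refine strictMonoOn_of_deriv_pos (convex_Ioi 0)
      (fun x hx => (hf x hx).continuousAt.continuousWithinAt) fun x hx => ?_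
    rw [interior_Ioi] at hx
    rw [(hf x hx).deriv]
    exact hf' x hx
  have hhalf : 0 < t / 2 := half_pos ht
  have hle : 0 ≤ f (t / 2) := by
    refine le_of_tendsto h0 ?_
    filter_upwards [Ioo_mem_nhdsGT hhalf] with x hx
    exact (hmono hx.1 hhalf hx.2).le
  exact hle.trans_lt (hmono hhalf ht (half_lt_self ht))

theorem pos_of_hasDerivAt_pos_of_map_zero {f f' : ℝ → ℝ}
    (hf : ∀ x, HasDerivAt f (f' x) x) (hf' : ∀ x, 0 < x → 0 < f' x)
    (h0 : f 0 = 0) {t : ℝ} (ht : 0 < t) : 0 < f t := by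
  refine pos_of_hasDerivAt_pos_of_tendsto_zero_s18 (fun x _ => hf x) hf' ?_ ht
  have h := (hf 0).continuousAt.tendsto
  rw [h0] at h
  exact h.mono_left nhdsWithin_le_nhds

theorem Real.sinh_lt_mul_cosh {t : ℝ} (ht : 0 < t) : sinh t < t * cosh t := by
  have h := pos_of_hasDerivAt_pos_of_map_zero
    (f := fun x => x * cosh x - sinh x) (f' := fun x => x * sinh x)
    (fun x => by
      refine HasDerivAt.congr_deriv
        (((hasDerivAt_id' x).mul (hasDerivAt_cosh x)).sub (hasDerivAt_sinh x)) ?_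
      ring)
    (fun x hx => mul_pos hx (sinh_pos_iff.2 hx)) (by simp) ht
  linarith

theorem Real.one_add_sq_half_lt_cosh {t : ℝ} (ht : 0 < t) : 1 + t ^ 2 / 2 < cosh t := by
  have h := pos_of_hasDerivAt_pos_of_map_zero
    (f := fun x => cosh x - 1 - x ^ 2 / 2) (f' := fun x => sinh x - x)
    (fun x => by
      refine HasDerivAt.congr_deriv
        (((hasDerivAt_cosh x).sub_const 1).sub ((hasDerivAt_pow 2 x).div_const 2)) ?_
      simp)
    (fun x hx => sub_pos.2 (self_lt_sinh_iff.2 hx)) (by simp) ht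
  linarith

/-- Multiplied out, this is `2 < (t / sinh t) ^ 2 + t / tanh t`. -/
theorem Real.two_mul_sinh_sq_lt {t : ℝ} (ht : 0 < t) :
    2 * sinh t ^ 2 < t * sinh t * cosh t + t ^ 2 := by
  have h1 : ∀ x : ℝ, 0 < x → 0 < x * (2 * cosh x ^ 2 + 1) - 3 * (sinh x * cosh x) := fun x hx =>
    pos_of_hasDerivAt_pos_of_map_zero
      (f := fun x => x * (2 * cosh x ^ 2 + 1) - 3 * (sinh x * cosh x))
      (f' := fun x => 4 * (sinh x * (x * cosh x - sinh x)))
      (fun x => by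
        refine HasDerivAt.congr_deriv
          (((hasDerivAt_id' x).mul ((((hasDerivAt_cosh x).pow 2).const_mul 2).add_const 1)).sub
          (((hasDerivAt_sinh x).mul (hasDerivAt_cosh x)).const_mul 3)) ?_
        simp only [Pi.pow_apply]
        linear_combination (-1 : ℝ) * cosh_sq x)
      (fun x hx => by
        have := sinh_pos_iff.2 hx
        have := sub_pos.2 (sinh_lt_mul_cosh hx)
        positivity) (by simp) hx
  have h := pos_of_hasDerivAt_pos_of_map_zero
    (f := fun x => x * (sinh x * cosh x) + x ^ 2 - 2 * sinh x ^ 2)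
    (f' := fun x => x * (2 * cosh x ^ 2 + 1) - 3 * (sinh x * cosh x))
    (fun x => by
      refine HasDerivAt.congr_deriv
        ((((hasDerivAt_id' x).mul ((hasDerivAt_sinh x).mul (hasDerivAt_cosh x))).add
        (hasDerivAt_pow 2 x)).sub (((hasDerivAt_sinh x).pow 2).const_mul 2)) ?_
      push_cast
      simp only [Pi.mul_apply]
      linear_combination -x * cosh_sq x)
    h1 (by simp) ht
  linarith

/-- A hyperbolic Wilker inequality: multiplied out and with `t` replaced by `2 * t`, this is
`2 < (sinh t / t) ^ 2 + tanh t / t`. -/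
theorem Real.sq_mul_one_add_cosh_lt {t : ℝ} (ht : 0 < t) :
    t ^ 2 * (1 + cosh t) < sinh t ^ 2 + t * sinh t := by
  have h2 : ∀ x : ℝ, 0 < x → 0 < 4 * sinh x ^ 2 - 3 * (x * sinh x) - x ^ 2 * cosh x := fun x hx =>
    pos_of_hasDerivAt_pos_of_map_zero
      (f := fun x => 4 * sinh x ^ 2 - 3 * (x * sinh x) - x ^ 2 * cosh x)
      (f' := fun x => 8 * (sinh x * cosh x) - 3 * sinh x - 5 * (x * cosh x) - x ^ 2 * sinh x)
      (fun x => by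
        refine HasDerivAt.congr_deriv (((((hasDerivAt_sinh x).pow 2).const_mul 4).sub
          (((hasDerivAt_id' x).mul (hasDerivAt_sinh x)).const_mul 3)).sub
          ((hasDerivAt_pow 2 x).mul (hasDerivAt_cosh x))) ?_
        push_cast
        ring)
      (fun x hx => by
        have hs := sinh_pos_iff.2 hx
        have hc := one_add_sq_half_lt_cosh hx
        have hsx := self_lt_sinh_iff.2 hx
        have h1 := mul_pos (sub_pos.2 hsx) (cosh_pos x)
        have h2 := mul_pos hs (sub_pos.2 hc)
        have h3 : 0 < sinh x * x ^ 2 := by positivity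
        linarith) (by simp) hx
  have h1 : ∀ x : ℝ, 0 < x →
      0 < 2 * (sinh x * cosh x) + sinh x - x * cosh x - 2 * x - x ^ 2 * sinh x := fun x hx =>
    pos_of_hasDerivAt_pos_of_map_zero
      (f := fun x => 2 * (sinh x * cosh x) + sinh x - x * cosh x - 2 * x - x ^ 2 * sinh x)
      (f' := fun x => 4 * sinh x ^ 2 - 3 * (x * sinh x) - x ^ 2 * cosh x)
      (fun x => by
        refine HasDerivAt.congr_deriv
          (((((((hasDerivAt_sinh x).mul (hasDerivAt_cosh x)).const_mul 2).add
          (hasDerivAt_sinh x)).sub ((hasDerivAt_id' x).mul (hasDerivAt_cosh x))).sub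
          ((hasDerivAt_id' x).const_mul 2)).sub
          ((hasDerivAt_pow 2 x).mul (hasDerivAt_sinh x))) ?_
        push_cast
        linear_combination 2 * cosh_sq x)
      h2 (by simp) hx
  have h := pos_of_hasDerivAt_pos_of_map_zero
    (f := fun x => sinh x ^ 2 + x * sinh x - x ^ 2 * (1 + cosh x))
    (f' := fun x => 2 * (sinh x * cosh x) + sinh x - x * cosh x - 2 * x - x ^ 2 * sinh x)
    (fun x => by
      refine HasDerivAt.congr_deriv
        ((((hasDerivAt_sinh x).pow 2).add ((hasDerivAt_id' x).mul (hasDerivAt_sinh x))).sub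
        ((hasDerivAt_pow 2 x).mul ((hasDerivAt_cosh x).const_add 1))) ?_
      push_cast
      ring)
    h1 (by simp) ht
  linarith

theorem Real.tendsto_sinh_div_self : Tendsto (fun t : ℝ => sinh t / t) (𝓝[>] 0) (𝓝 1) := by
  have h := (hasDerivAt_sinh 0).tendsto_slope_zero_right
  simp only [zero_add, sinh_zero, sub_zero, cosh_zero, smul_eq_mul] at h
  exact h.congr fun t => by rw [div_eq_inv_mul]

theorem Real.tendsto_mul_cosh_div_sinh :
    Tendsto (fun t : ℝ => t * cosh t / sinh t) (𝓝[>] 0) (𝓝 1) := by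
  have hc : Tendsto cosh (𝓝[>] 0) (𝓝 1) := by
    simpa using (continuous_cosh.tendsto 0).mono_left nhdsWithin_le_nhds
  have h := hc.div tendsto_sinh_div_self one_ne_zero
  rw [div_one] at h
  exact h.congr fun t => by rw [Pi.div_apply, div_div_eq_mul_div, mul_comm]

theorem Real.hasDerivAt_mul_cosh_div_sinh {t : ℝ} (ht : 0 < t) :
    HasDerivAt (fun t => t * cosh t / sinh t) ((sinh t * cosh t - t) / sinh t ^ 2) t := by
  have hs := sinh_pos_iff.2 ht
  refine HasDerivAt.congr_deriv
    (((hasDerivAt_id' t).mul (hasDerivAt_cosh t)).div (hasDerivAt_sinh t) hs.ne') ?_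
  congr 1
  simp only [Pi.mul_apply]
  linear_combination -t * cosh_sq t

theorem Real.hasDerivAt_sinh_div_self {t : ℝ} (ht : 0 < t) :
    HasDerivAt (fun t => sinh t / t) ((t * cosh t - sinh t) / t ^ 2) t := by
  refine HasDerivAt.congr_deriv ((hasDerivAt_sinh t).div (hasDerivAt_id' t) ht.ne') ?_
  ring

theorem Real.exp_mul_cosh_div_sinh_sub_one_lt {t : ℝ} (ht : 0 < t) :
    exp (t * cosh t / sinh t - 1) < (sinh t / t) ^ 2 := by
  have h := pos_of_hasDerivAt_pos_of_tendsto_zero_s18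
    (f := fun t => 2 * log (sinh t / t) - (t * cosh t / sinh t - 1))
    (f' := fun t => 2 * ((t * cosh t - sinh t) / t ^ 2 / (sinh t / t)) -
      (sinh t * cosh t - t) / sinh t ^ 2)
    (fun x hx => by
      have hs := sinh_pos_iff.2 hx
      exact (((hasDerivAt_sinh_div_self hx).log (by positivity)).const_mul 2).sub
        ((hasDerivAt_mul_cosh_div_sinh hx).sub_const 1))
    (fun x hx => by
      have hs := sinh_pos_iff.2 hx
      have key := sub_pos.2 (two_mul_sinh_sq_lt hx)
      have e : 2 * ((x * cosh x - sinh x) / x ^ 2 / (sinh x / x)) -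
          (sinh x * cosh x - x) / sinh x ^ 2 =
          (x * sinh x * cosh x + x ^ 2 - 2 * sinh x ^ 2) / (x * sinh x ^ 2) := by
        field_simp
        ring
      rw [e]
      positivity)
    (by
      simpa using ((tendsto_sinh_div_self.log one_ne_zero).const_mul 2).sub
        (tendsto_mul_cosh_div_sinh.sub_const 1)) ht
  have hs := sinh_pos_iff.2 ht
  rw [← lt_log_iff_exp_lt (by positivity), log_pow]
  push_cast
  linarith

theorem Real.exp_mul_cosh_div_sinh_sub_one_lt_one_add_cosh_sub {t : ℝ} (ht : 0 < t) :
    exp (t * cosh t / sinh t - 1) < 1 + cosh t - sinh t / t := by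
  have hpos : ∀ x : ℝ, 0 < x → 0 < 1 + cosh x - sinh x / x := fun x hx => by
    have := (div_lt_iff₀' hx).2 (sinh_lt_mul_cosh hx)
    linarith
  have h := pos_of_hasDerivAt_pos_of_tendsto_zero_s18
    (f := fun t => log (1 + cosh t - sinh t / t) - (t * cosh t / sinh t - 1))
    (f' := fun t => (sinh t - (t * cosh t - sinh t) / t ^ 2) / (1 + cosh t - sinh t / t) -
      (sinh t * cosh t - t) / sinh t ^ 2)
    (fun x hx =>
      ((((hasDerivAt_cosh x).const_add 1).sub (hasDerivAt_sinh_div_self hx)).log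
        (hpos x hx).ne').sub ((hasDerivAt_mul_cosh_div_sinh hx).sub_const 1))
    (fun x hx => by
      have hs := sinh_pos_iff.2 hx
      have hd := hpos x hx
      have key := mul_pos (sub_pos.2 (self_lt_sinh_iff.2 hx))
        (sub_pos.2 (sq_mul_one_add_cosh_lt hx))
      have e : (sinh x - (x * cosh x - sinh x) / x ^ 2) / (1 + cosh x - sinh x / x) -
          (sinh x * cosh x - x) / sinh x ^ 2 =
          (sinh x - x) * (sinh x ^ 2 + x * sinh x - x ^ 2 * (1 + cosh x)) /
            (x ^ 2 * sinh x ^ 2 * (1 + cosh x - sinh x / x)) := by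
        rw [div_sub_div _ _ hd.ne' (by positivity),
          div_eq_div_iff (by positivity) (by positivity)]
        field_simp
        linear_combination
          -(x * (1 + cosh x) - sinh x) * x ^ 2 * sinh x * cosh_sq x
      rw [e]
      positivity)
    (by
      have hc : Tendsto cosh (𝓝[>] 0) (𝓝 1) := by
        simpa using (continuous_cosh.tendsto 0).mono_left nhdsWithin_le_nhds
      have hl := (hc.const_add 1).sub tendsto_sinh_div_self
      simpa using (hl.log (by norm_num)).sub (tendsto_mul_cosh_div_sinh.sub_const 1)) ht
  rw [← lt_log_iff_exp_lt (hpos t ht)]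
  linarith

theorem Gm_exp (g t : ℝ) : Gm (exp (g + t)) (exp (g - t)) = exp g := by
  rw [Gm, ← exp_add, show g + t + (g - t) = g + g by ring, exp_add, sqrt_mul_self (exp_pos g).le]

theorem exp_add_sub_exp_sub (g t : ℝ) : exp (g + t) - exp (g - t) = 2 * exp g * sinh t := by
  rw [sinh_eq, sub_eq_add_neg g t, exp_add, exp_add]
  ring

theorem exp_add_add_exp_sub (g t : ℝ) : exp (g + t) + exp (g - t) = 2 * exp g * cosh t := by
  rw [cosh_eq, sub_eq_add_neg g t, exp_add, exp_add]
  ring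

theorem Lm_exp (g t : ℝ) : Lm (exp (g + t)) (exp (g - t)) = exp g * (sinh t / t) := by
  rw [Lm, log_exp, log_exp, exp_add_sub_exp_sub, show g + t - (g - t) = 2 * t by ring, mul_assoc,
    mul_div_mul_left _ _ two_ne_zero, mul_div_assoc]

theorem Hm_exp (g t : ℝ) : Hm (exp (g + t)) (exp (g - t)) = exp g / cosh t := by
  have hc := cosh_pos t
  rw [Hm, exp_add_add_exp_sub, mul_assoc, ← exp_add, show g + t + (g - t) = g + g by ring, exp_add]
  field_simp

theorem Im_exp (g : ℝ) {t : ℝ} (ht : t ≠ 0) :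
    Im (exp (g + t)) (exp (g - t)) = exp g * exp (t * cosh t / sinh t - 1) := by
  have hs : sinh t ≠ 0 := sinh_ne_zero.2 ht
  have hg := exp_ne_zero g
  rw [Im, ← exp_mul, ← exp_mul, ← exp_sub, ← exp_mul, one_div, ← exp_neg, ← exp_add, ← exp_add]
  congr 1
  have e : (g + t) * exp (g + t) - (g - t) * exp (g - t) =
      g * (2 * exp g * sinh t) + t * (2 * exp g * cosh t) := by
    rw [← exp_add_sub_exp_sub, ← exp_add_add_exp_sub]
    ring
  rw [e, exp_add_sub_exp_sub]
  field_simp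
  ring

theorem Real.exp_mul_cosh_div_sinh_sub_one_bounds {t : ℝ} (ht : t ≠ 0) :
    0 < sinh t / t ∧ exp (t * cosh t / sinh t - 1) < (sinh t / t) ^ 2 ∧
      exp (t * cosh t / sinh t - 1) < 1 + cosh t - sinh t / t := by
  have hpos : ∀ x : ℝ, 0 < x → 0 < sinh x / x ∧
      exp (x * cosh x / sinh x - 1) < (sinh x / x) ^ 2 ∧
      exp (x * cosh x / sinh x - 1) < 1 + cosh x - sinh x / x := fun x hx =>
    ⟨div_pos (sinh_pos_iff.2 hx) hx, exp_mul_cosh_div_sinh_sub_one_lt hx,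
      exp_mul_cosh_div_sinh_sub_one_lt_one_add_cosh_sub hx⟩
  rcases ht.lt_or_gt with h | h
  · simpa only [sinh_neg, cosh_neg, neg_mul, neg_div_neg_eq] using hpos (-t) (neg_pos.2 h)
  · exact hpos t h

theorem stmt_18 (a b : ℝ) (ha : 0 < a) (hb : 0 < b) (hab : a ≠ b) :
    Im a b / Lm a b < Lm a b / Gm a b ∧
    Lm a b / Gm a b < 1 + Gm a b / Hm a b - Im a b / Gm a b := by
  obtain ⟨g, t, rfl, rfl⟩ : ∃ g t, a = exp (g + t) ∧ b = exp (g - t) := by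
    refine ⟨(log a + log b) / 2, (log a - log b) / 2, ?_, ?_⟩
    · rw [← add_div, add_add_sub_cancel, add_self_div_two, exp_log ha]
    · rw [← sub_div, add_sub_sub_cancel, add_self_div_two, exp_log hb]
  have ht : t ≠ 0 := by
    rintro rfl
    simp at hab
  obtain ⟨hx, h1, h2⟩ := exp_mul_cosh_div_sinh_sub_one_bounds ht
  have hg := exp_pos g
  rw [Im_exp g ht, Lm_exp, Gm_exp, Hm_exp, mul_div_mul_left _ _ hg.ne',
    mul_div_cancel_left₀ _ hg.ne', mul_div_cancel_left₀ _ hg.ne', div_div_cancel₀ hg.ne']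
  exact ⟨by rwa [div_lt_iff₀ hx, ← sq], by linarith⟩
end

section
/- For all real numbers a, b > 0 with a ≠ b, one has A/e < (π/(2e))·P < X < P, where e is Euler's number. -/
open Real

theorem strictAntiOn_mul_cot_sub_log_sinc :
    StrictAntiOn (fun t : ℝ => t * cos t / sin t - log (sin t) + log t) (Set.Ioc 0 (π / 2)) := by
  have hsin : ∀ t ∈ Set.Ioc (0 : ℝ) (π / 2), 0 < sin t := fun t ht =>
    sin_pos_of_pos_of_lt_pi ht.1 (by linarith [ht.2, pi_pos])
  have hderiv : ∀ t ∈ Set.Ioc (0 : ℝ) (π / 2),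
      HasDerivAt (fun t : ℝ => t * cos t / sin t - log (sin t) + log t)
        (1 / t - t / sin t ^ 2) t := by
    intro t ht
    have hs := (hsin t ht).ne'
    have ht0 := ht.1.ne'
    have h := ((((hasDerivAt_id t).mul (hasDerivAt_cos t)).div (hasDerivAt_sin t) hs).sub
      ((hasDerivAt_sin t).log hs)).add (hasDerivAt_log ht0)
    refine h.congr_deriv ?_
    simp only [id, Pi.mul_apply]
    field_simp
    linear_combination (-t ^ 2) * sin_sq_add_cos_sq t
  refine strictAntiOn_of_deriv_neg (convex_Ioc 0 (π / 2))
    (fun t ht => (hderiv t ht).continuousAt.continuousWithinAt) ?_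
  intro t ht
  rw [interior_Ioc] at ht
  have ht' := Set.Ioo_subset_Ioc_self ht
  rw [(hderiv t ht').deriv, sub_neg, div_lt_div_iff₀ ht.1 (pow_pos (hsin t ht') 2)]
  nlinarith [sin_lt ht.1, hsin t ht']

theorem half_pi_mul_sin_div_lt_exp_mul_cot {t : ℝ} (h0 : 0 < t) (h1 : t < π / 2) :
    π / 2 * (sin t / t) < exp (t * cos t / sin t) := by
  have hs : 0 < sin t := sin_pos_of_pos_of_lt_pi h0 (by linarith)
  have hpi : 0 < π / 2 := by positivity
  have h := strictAntiOn_mul_cot_sub_log_sinc ⟨h0, h1.le⟩ ⟨hpi, le_rfl⟩ h1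
  simp only [cos_pi_div_two, sin_pi_div_two, log_one] at h
  rw [← log_lt_iff_lt_exp (by positivity), log_mul hpi.ne' (by positivity),
    log_div hs.ne' h0.ne']
  linarith

theorem exp_mul_cot_sub_one_lt_sin_div {t : ℝ} (h0 : 0 < t) (h1 : t < π / 2) :
    exp (t * cos t / sin t - 1) < sin t / t := by
  have hs : 0 < sin t := sin_pos_of_pos_of_lt_pi h0 (by linarith)
  have hlog := one_sub_inv_le_log_of_pos (div_pos hs h0)
  rw [← lt_log_iff_exp_lt (by positivity)]
  refine lt_of_lt_of_le ?_ hlog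
  have hc : 0 < cos (t / 2) := cos_pos_of_mem_Ioo ⟨by linarith, by linarith⟩
  have htan : t / 2 < tan (t / 2) := lt_tan (by linarith) (by linarith)
  rw [tan_eq_sin_div_cos, lt_div_iff₀ hc] at htan
  have hsin : sin t = 2 * sin (t / 2) * cos (t / 2) := by
    rw [← sin_two_mul]; ring_nf
  have hcos : cos t = 2 * cos (t / 2) ^ 2 - 1 := by
    rw [← cos_two_mul]; ring_nf
  have key : t * cos t + t < 2 * sin t := by
    rw [hsin, hcos]
    nlinarith [mul_lt_mul_of_pos_right htan hc]
  have hlt : (t * cos t + t) / sin t < 2 := (div_lt_iff₀ hs).2 key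
  rw [inv_div]
  rw [add_div] at hlt
  linarith

/-- Seiffert's parametrization of the means by `t = arcsin ((a - b) / (a + b))`. -/
theorem exists_angle_means {a b : ℝ} (hb : 0 < b) (hab : b < a) :
    ∃ t, 0 < t ∧ t < π / 2 ∧ Pm a b = Am a b * (sin t / t) ∧
      Xm a b = Am a b * exp (t * cos t / sin t - 1) := by
  have hsum : 0 < a + b := by linarith
  have hx0 : 0 < (a - b) / (a + b) := div_pos (by linarith) hsum
  have hx1 : (a - b) / (a + b) < 1 := (div_lt_one hsum).2 (by linarith)
  have ht0 := arcsin_pos.2 hx0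
  have hsin := sin_arcsin (by linarith) hx1.le
  have hA : 0 < Am a b := by unfold Am; positivity
  have hG : Gm a b = Am a b * cos (arcsin ((a - b) / (a + b))) := by
    have h : a * b = Am a b ^ 2 * (1 - ((a - b) / (a + b)) ^ 2) := by
      unfold Am; field_simp; ring
    rw [Gm, cos_arcsin, h, sqrt_mul (sq_nonneg _), sqrt_sq hA.le]
  have hP : Pm a b = Am a b *
      (sin (arcsin ((a - b) / (a + b))) / arcsin ((a - b) / (a + b))) := by
    rw [hsin, Pm, Am]; field_simp
  refine ⟨_, ht0, arcsin_lt_pi_div_two.2 hx1, hP, ?_⟩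
  have hs := hx0
  rw [← hsin] at hs
  rw [Xm, hP, hG]
  congr 3
  field_simp

theorem stmt_19 (a b : ℝ) (ha : 0 < a) (hb : 0 < b) (hab : a ≠ b) :
    Am a b / Real.exp 1 < (π / (2 * Real.exp 1)) * Pm a b ∧
    (π / (2 * Real.exp 1)) * Pm a b < Xm a b ∧
    Xm a b < Pm a b := by
  wlog hlt : b < a generalizing a b
  · rw [Am_comm, Pm_comm, Xm_comm]
    exact this b a hb ha hab.symm (lt_of_le_of_ne (not_lt.1 hlt) hab)
  obtain ⟨t, h0, h1, hP, hX⟩ := exists_angle_means hb hlt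
  have hA : 0 < Am a b := by unfold Am; positivity
  have hjordan : 1 < π / 2 * (sin t / t) := by
    have h := mul_lt_sin h0 h1
    rw [div_mul_eq_mul_div, div_lt_iff₀ pi_pos] at h
    rw [← mul_div_assoc, one_lt_div h0]
    linarith
  have hPe : π / (2 * exp 1) * Pm a b = Am a b * (π / 2 * (sin t / t)) / exp 1 := by
    rw [hP]; field_simp
  refine ⟨?_, ?_, ?_⟩
  · rw [hPe]
    exact div_lt_div_of_pos_right (lt_mul_of_one_lt_right hA hjordan) (exp_pos 1)
  · rw [hPe, hX, exp_sub, ← mul_div_assoc (Am a b)]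
    exact div_lt_div_of_pos_right
      (mul_lt_mul_of_pos_left (half_pi_mul_sin_div_lt_exp_mul_cot h0 h1) hA) (exp_pos 1)
  · rw [hP, hX]
    exact mul_lt_mul_of_pos_left (exp_mul_cot_sub_one_lt_sin_div h0 h1) hA
end
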